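/- Let α > 1, p ≥ 0 and ω > 0. The linearised IBA equation l(x) = −2p + 𝕂_ω[l](x) for x ∈ [ω,∞) admits a unique continuous solution l with sup_{x≥ω} x^{−(1+α)/(2α)}|l(x)| < ∞ and lim_{x→∞} x^{−(1+α)/(2α)} l(x) = 1; it is given explicitly by l(x) = l̄(x/ω; ω, p) where l̄(ξ; ω, p) = p·τ(ξ) − (2α/(1+α))·[p − (ω/A)^{(1+α)/(2α)}]·Dτ(ξ). Moreover l̄(1; ω, p) = √(2(1+α))·[(ω/A)^{(1+α)/(2α)} − p]. -/

import Mathlib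

open Real MeasureTheory Set Filter Topology Asymptotics

noncomputable section

/-- The kernel `K_α`. -/
def Ka (α x : ℝ) : ℝ :=
  (Real.sin (2 * π / (1 + α)) / π) *
    (x / (1 + x ^ 2 - 2 * x * Real.cos (2 * π / (1 + α))))

/-- The convolution operator 𝕂_J. -/
def Kconv (α : ℝ) (J : Set ℝ) (f : ℝ → ℝ) (x : ℝ) : ℝ :=
  ∫ y in J, Ka α (x / y) * f y / y

/-- The Euler operator D = x d/dx, with the derivative taken within a set. -/
def eulerDW (s : Set ℝ) (f : ℝ → ℝ) : ℝ → ℝ := fun x => x * derivWithin f s x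

/-- V(u;x) = x u² − u^{2α+2} − 1. -/
def Vfun (α x u : ℝ) : ℝ := x * u ^ 2 - u ^ (2 * α + 2) - 1

/-- ρ = ((α+1)/α)·α^{1/(α+1)}. -/
def rhoC (α : ℝ) : ℝ := ((α + 1) / α) * α ^ (1 / (α + 1))

/-- The smaller positive root u₁(x) of V(·;x). -/
def u1F (α x : ℝ) : ℝ := sInf {u : ℝ | 0 < u ∧ Vfun α x u = 0}

/-- The larger positive root u₂(x) of V(·;x). -/
def u2F (α x : ℝ) : ℝ := sSup {u : ℝ | 0 < u ∧ Vfun α x u = 0}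

/-- The WKB integral S(x). -/
def Sfun (α x : ℝ) : ℝ :=
  if rhoC α < x then (1/π) * ∫ u in u1F α x..u2F α x, Real.sqrt (Vfun α x u) / u else 0

/-- τ(ξ) = 2(1+α)·S(ρξ). -/
def tauF (α ξ : ℝ) : ℝ := 2 * (1 + α) * Sfun α (rhoC α * ξ)

/-- The constant A. -/
def Aconst (α : ℝ) : ℝ :=
  (1 + α) * (Real.Gamma (1 / (2 * α)) /
    (Real.sqrt (π * α) * Real.Gamma ((1 + α) / (2 * α)))) ^ (2 * α / (α + 1))

/-- The Euler derivative Dτ of τ, within [1,∞). -/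
def Dtau (α ξ : ℝ) : ℝ := eulerDW (Set.Ici 1) (tauF α) ξ

/-- The rescaled solution l̄(ξ; ω, p) of the linearised IBA equation. -/
def lbar (α ω p ξ : ℝ) : ℝ :=
  p * tauF α ξ - (2 * α / (1 + α)) * (p - (ω / Aconst α) ^ ((1 + α) / (2 * α))) * Dtau α ξ

/-- The quadratic form `|x e^{iφ} - y|²`. -/
def kerQuad (φ x y : ℝ) : ℝ := x ^ 2 + y ^ 2 - 2 * x * y * Real.cos φ

/-- The kernel `K(x/y)/y`, for a general angle `φ`. -/
def kerAngle (φ x y : ℝ) : ℝ := (Real.sin φ / π) * (x / kerQuad φ x y)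

/-- The Euler derivative of `kerAngle` in its first variable. -/
def kerEuler (φ x y : ℝ) : ℝ :=
  (Real.sin φ / π) * (x * (y ^ 2 - x ^ 2) / kerQuad φ x y ^ 2)

lemma Ka_div_eq {α x y : ℝ} (hy : 0 < y) (f : ℝ) :
    Ka α (x / y) * f / y = kerAngle (2 * π / (1 + α)) x y * f := by
  unfold Ka kerAngle kerQuad
  have h : 1 + (x / y) ^ 2 - 2 * (x / y) * Real.cos (2 * π / (1 + α)) =
      (x ^ 2 + y ^ 2 - 2 * x * y * Real.cos (2 * π / (1 + α))) / y ^ 2 := by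
    field_simp
    ring
  rw [h, div_div_div_eq]
  by_cases hq : x ^ 2 + y ^ 2 - 2 * x * y * Real.cos (2 * π / (1 + α)) = 0
  · simp [hq]
  · field_simp

lemma one_sub_abs_cos_pos {φ : ℝ} (h0 : 0 < φ) (h1 : φ < π) : 0 < 1 - |Real.cos φ| := by
  have hs := Real.sin_pos_of_pos_of_lt_pi h0 h1
  have : |Real.cos φ| < 1 := by
    rw [← sq_lt_one_iff_abs_lt_one]
    nlinarith [Real.sin_sq_add_cos_sq φ]
  linarith

lemma kerQuad_ge (φ x y : ℝ) :
    (1 - |Real.cos φ|) * (x ^ 2 + y ^ 2) ≤ kerQuad φ x y := by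
  unfold kerQuad
  have h1 : 2 * x * y * Real.cos φ ≤ |2 * x * y| * |Real.cos φ| := by
    rw [← abs_mul]; exact le_abs_self _
  have h2 : |2 * x * y| ≤ x ^ 2 + y ^ 2 := by
    rw [abs_le]; constructor <;> nlinarith [sq_nonneg (x + y), sq_nonneg (x - y)]
  nlinarith [abs_nonneg (Real.cos φ), mul_le_mul_of_nonneg_right h2 (abs_nonneg (Real.cos φ))]

lemma kerQuad_pos {φ x : ℝ} (h0 : 0 < φ) (h1 : φ < π) (hx : 0 < x) (y : ℝ) :
    0 < kerQuad φ x y :=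
  lt_of_lt_of_le (mul_pos (one_sub_abs_cos_pos h0 h1) (by positivity)) (kerQuad_ge φ x y)

lemma kerAngle_pos {φ x : ℝ} (h0 : 0 < φ) (h1 : φ < π) (hx : 0 < x) (y : ℝ) :
    0 < kerAngle φ x y :=
  mul_pos (div_pos (Real.sin_pos_of_pos_of_lt_pi h0 h1) pi_pos)
    (div_pos hx (kerQuad_pos h0 h1 hx y))

lemma kerAngle_le {φ x : ℝ} (h0 : 0 < φ) (h1 : φ < π) (hx : 0 < x) (y : ℝ) :
    kerAngle φ x y ≤ (1 - |Real.cos φ|)⁻¹ * (x / (x ^ 2 + y ^ 2)) := by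
  have hc := one_sub_abs_cos_pos h0 h1
  have hs := Real.sin_pos_of_pos_of_lt_pi h0 h1
  have h2 : Real.sin φ / π ≤ 1 := by
    rw [div_le_one pi_pos]
    linarith [Real.sin_le_one φ, Real.pi_gt_three]
  have hq := kerQuad_ge φ x y
  have h3 : x / kerQuad φ x y ≤ (1 - |Real.cos φ|)⁻¹ * (x / (x ^ 2 + y ^ 2)) := by
    rw [inv_mul_eq_div, div_div, mul_comm]
    rw [mul_comm] at hq
    exact div_le_div_of_nonneg_left hx.le (by positivity) (by linarith)
  have h4 : 0 ≤ x / kerQuad φ x y := (div_pos hx (kerQuad_pos h0 h1 hx y)).le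
  unfold kerAngle
  nlinarith

lemma abs_kerEuler_le {φ x : ℝ} (h0 : 0 < φ) (h1 : φ < π) (hx : 0 < x) (y : ℝ) :
    |kerEuler φ x y| ≤ (1 - |Real.cos φ|)⁻¹ * kerAngle φ x y := by
  have hc := one_sub_abs_cos_pos h0 h1
  have hs := div_pos (Real.sin_pos_of_pos_of_lt_pi h0 h1) pi_pos
  have hq := kerQuad_pos h0 h1 hx y
  have hge := kerQuad_ge φ x y
  unfold kerEuler kerAngle
  rw [abs_mul, abs_of_pos hs, abs_div, abs_mul, abs_of_pos hx, abs_of_pos (pow_pos hq 2)]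
  have h2 : |y ^ 2 - x ^ 2| ≤ (1 - |Real.cos φ|)⁻¹ * kerQuad φ x y := by
    rw [inv_mul_eq_div, le_div_iff₀ hc, abs_sub_comm]
    have : |x ^ 2 - y ^ 2| ≤ x ^ 2 + y ^ 2 := by
      rw [abs_le]; constructor <;> nlinarith [sq_nonneg x, sq_nonneg y]
    nlinarith
  calc Real.sin φ / π * (x * |y ^ 2 - x ^ 2| / kerQuad φ x y ^ 2)
      ≤ Real.sin φ / π *
          (x * ((1 - |Real.cos φ|)⁻¹ * kerQuad φ x y) / kerQuad φ x y ^ 2) := by gcongr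
    _ = (1 - |Real.cos φ|)⁻¹ * (Real.sin φ / π * (x / kerQuad φ x y)) := by
        field_simp

lemma hasDerivAt_kerAngle {φ x : ℝ} (h0 : 0 < φ) (h1 : φ < π) (hx : 0 < x) (y : ℝ) :
    HasDerivAt (fun x => kerAngle φ x y) (kerEuler φ x y / x) x := by
  have hq := kerQuad_pos h0 h1 hx y
  have hd : HasDerivAt (fun x => kerQuad φ x y) (2 * x - 2 * y * Real.cos φ) x := by
    unfold kerQuad
    refine (((hasDerivAt_pow 2 x).add_const (y ^ 2)).sub
      ((((hasDerivAt_id x).const_mul 2).mul_const y).mul_const (Real.cos φ))).congr_deriv ?_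
    simp
  refine (((hasDerivAt_id x).div hd hq.ne').const_mul (Real.sin φ / π)).congr_deriv ?_
  unfold kerEuler
  field_simp
  unfold kerQuad
  simp only [id]
  ring

lemma hasDerivAt_mul_kerAngle {φ x : ℝ} (h0 : 0 < φ) (h1 : φ < π) (hx : 0 < x) (y : ℝ) :
    HasDerivAt (fun y => y * kerAngle φ x y) (-kerEuler φ x y) y := by
  have hq := kerQuad_pos h0 h1 hx y
  have hd : HasDerivAt (fun y => kerQuad φ x y) (2 * y - 2 * x * Real.cos φ) y := by
    unfold kerQuad
    refine (((hasDerivAt_pow 2 y).const_add (x ^ 2)).sub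
      (((hasDerivAt_id y).const_mul (2 * x)).mul_const (Real.cos φ))).congr_deriv ?_
    simp
  have h := (hasDerivAt_id y).mul
    (((hasDerivAt_const y x).div hd hq.ne').const_mul (Real.sin φ / π))
  refine h.congr_deriv ?_
  unfold kerEuler
  simp only [id, Pi.div_apply]
  field_simp
  unfold kerQuad
  ring

lemma kerQuad_scale (φ c x y : ℝ) : kerQuad φ (c * x) (c * y) = c ^ 2 * kerQuad φ x y := by
  unfold kerQuad; ring

lemma kerAngle_scale {c : ℝ} (hc : 0 < c) (φ x y : ℝ) :
    kerAngle φ (c * x) (c * y) = c⁻¹ * kerAngle φ x y := by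
  unfold kerAngle
  rw [kerQuad_scale]
  by_cases h : kerQuad φ x y = 0
  · simp [h]
  · field_simp

lemma kerEuler_scale {c : ℝ} (hc : 0 < c) (φ x y : ℝ) :
    kerEuler φ (c * x) (c * y) = c⁻¹ * kerEuler φ x y := by
  unfold kerEuler
  rw [kerQuad_scale]
  by_cases h : kerQuad φ x y = 0
  · simp [h]
  · field_simp

lemma continuous_kerAngle {φ x : ℝ} (h0 : 0 < φ) (h1 : φ < π) (hx : 0 < x) :
    Continuous (kerAngle φ x) := by
  unfold kerAngle
  refine continuous_const.mul (continuous_const.div ?_ fun y => (kerQuad_pos h0 h1 hx y).ne')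
  unfold kerQuad; fun_prop

lemma continuous_kerEuler {φ x : ℝ} (h0 : 0 < φ) (h1 : φ < π) (hx : 0 < x) :
    Continuous (kerEuler φ x) := by
  unfold kerEuler
  refine continuous_const.mul (Continuous.div ?_ ?_ fun y =>
    (pow_pos (kerQuad_pos h0 h1 hx y) 2).ne')
  · fun_prop
  · unfold kerQuad; fun_prop

lemma integrableOn_kerAngle_mul_rpow {φ β x : ℝ} (h0 : 0 < φ) (h1 : φ < π) (hβ0 : 0 < β)
    (hβ1 : β < 1) (hx : 0 < x) :
    IntegrableOn (fun y => kerAngle φ x y * y ^ β) (Ioi 0) := by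
  have hc := one_sub_abs_cos_pos h0 h1
  have hcont : Continuous fun y : ℝ => kerAngle φ x y * y ^ β :=
    (continuous_kerAngle h0 h1 hx).mul (Real.continuous_rpow_const hβ0.le)
  rw [← Ioc_union_Ioi_eq_Ioi (zero_le_one' ℝ)]
  refine IntegrableOn.union (hcont.integrableOn_Ioc) ?_
  have hi : IntegrableOn (fun y : ℝ => (1 - |Real.cos φ|)⁻¹ * x * y ^ (β - 2)) (Ioi 1) :=
    (integrableOn_Ioi_rpow_of_lt (by linarith) one_pos).const_mul _
  refine hi.mono' hcont.aestronglyMeasurable.restrict ?_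
  filter_upwards [ae_restrict_mem measurableSet_Ioi] with y hy
  have hy0 : (0:ℝ) < y := lt_trans one_pos hy
  rw [Real.norm_of_nonneg (mul_nonneg (kerAngle_pos h0 h1 hx y).le (rpow_nonneg hy0.le _))]
  calc kerAngle φ x y * y ^ β
      ≤ (1 - |Real.cos φ|)⁻¹ * (x / y ^ 2) * y ^ β := by
        gcongr
        refine (kerAngle_le h0 h1 hx y).trans ?_
        gcongr
        nlinarith [sq_nonneg x]
    _ = (1 - |Real.cos φ|)⁻¹ * x * y ^ (β - 2) := by
        rw [Real.rpow_sub hy0, Real.rpow_two]; ring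

lemma csqrt_sq (z : ℂ) : (z ^ (2⁻¹ : ℂ)) ^ 2 = z := by
  simpa only [Nat.cast_ofNat] using Complex.cpow_nat_inv_pow z two_ne_zero

lemma csqrt_re_nonneg (z : ℂ) : 0 ≤ (z ^ (2⁻¹ : ℂ)).re := by
  rw [Complex.cpow_inv_two_re]; positivity

lemma csqrt_im_nonneg {z : ℂ} (h : 0 ≤ z.im) : 0 ≤ (z ^ (2⁻¹ : ℂ)).im := by
  rw [Complex.cpow_inv_two_im_eq_sqrt h]; positivity

lemma csqrt_im_pos {z : ℂ} (h : 0 < z.im) : 0 < (z ^ (2⁻¹ : ℂ)).im := by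
  refine lt_of_le_of_ne (csqrt_im_nonneg h.le) fun h0 => ?_
  have h2 := congrArg Complex.im (csqrt_sq z)
  simp only [pow_two, Complex.mul_im, ← h0] at h2
  simp at h2
  linarith

lemma csqrt_im_nonpos {z : ℂ} (h : z.im < 0) : (z ^ (2⁻¹ : ℂ)).im ≤ 0 := by
  rw [Complex.cpow_inv_two_im_eq_neg_sqrt h]
  have : 0 ≤ √((‖z‖ - z.re) / 2) := Real.sqrt_nonneg _
  linarith

/-- A primitive of the Stieltjes integrand in `integral_kerAngle_mul_sqrt`. -/
def stieltjesPrim (η : ℂ) (r : ℝ) : ℝ :=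
  (η * (Complex.log (r - η) - Complex.log (r + η))).im / π

lemma stieltjesPrim_zero {η : ℂ} (h : 0 < η.im) : stieltjesPrim η 0 = -η.re := by
  have h1 : Complex.log (-η) - Complex.log η = -(π * Complex.I) := by
    apply Complex.ext
    · simp [Complex.log_re]
    · simp [Complex.log_im, Complex.arg_neg_eq_arg_sub_pi_of_im_pos h]
  unfold stieltjesPrim
  simp only [Complex.ofReal_zero, zero_sub, zero_add, h1]
  simp
  field_simp

lemma tendsto_stieltjesPrim {η : ℂ} : Tendsto (stieltjesPrim η) atTop (𝓝 0) := by
  have h0 : Tendsto (fun r : ℝ => η / (r : ℂ)) atTop (𝓝 0) := by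
    have h := (Complex.continuous_ofReal.tendsto 0).comp tendsto_inv_atTop_zero
    simpa [div_eq_mul_inv] using h.const_mul η
  have hm : Tendsto (fun r : ℝ => Complex.log (1 - η / (r : ℂ))) atTop (𝓝 0) := by
    have : Tendsto (fun r : ℝ => 1 - η / (r : ℂ)) atTop (𝓝 1) := by
      simpa using h0.const_sub 1
    simpa using this.clog (by simp)
  have hp : Tendsto (fun r : ℝ => Complex.log (1 + η / (r : ℂ))) atTop (𝓝 0) := by
    have : Tendsto (fun r : ℝ => 1 + η / (r : ℂ)) atTop (𝓝 1) := by
      simpa using h0.const_add 1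
    simpa using this.clog (by simp)
  have h := (Complex.continuous_im.tendsto _).comp (((hm.sub hp).const_mul η))
  have h2 := h.div_const π
  simp only [sub_self, mul_zero, Complex.zero_im, zero_div] at h2
  have hne : ∀ s : ℂ, Tendsto (fun r : ℝ => 1 + s * (η / (r : ℂ))) atTop (𝓝 1) := fun s => by
    simpa using (h0.const_mul s).const_add 1
  have e1 := (hne 1).eventually_ne one_ne_zero
  have e2 := (hne (-1)).eventually_ne one_ne_zero
  refine h2.congr' ?_
  filter_upwards [eventually_gt_atTop 0, e1, e2] with r hr h1 h2
  have hr' : (r : ℂ) ≠ 0 := by exact_mod_cast hr.ne'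
  have a1 : (r : ℂ) - η = r * (1 - η / r) := by field_simp
  have a2 : (r : ℂ) + η = r * (1 + η / r) := by field_simp
  unfold stieltjesPrim
  rw [a1, a2, Complex.log_ofReal_mul hr (by simpa [sub_eq_add_neg] using h2),
    Complex.log_ofReal_mul hr (by simpa using h1)]
  simp

lemma hasDerivAt_stieltjesPrim {η : ℂ} (h : 0 < η.im) (r : ℝ) :
    HasDerivAt (stieltjesPrim η) ((2 * η ^ 2 / (r ^ 2 - η ^ 2)).im / π) r := by
  have hm : (r - η : ℂ) ∈ Complex.slitPlane := by
    right; simp [h.ne']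
  have hp : (r + η : ℂ) ∈ Complex.slitPlane := by
    right; simp [h.ne']
  have hr := Complex.ofRealCLM.hasDerivAt (x := r)
  simp only [Complex.ofRealCLM_apply, Complex.ofReal_one] at hr
  have d := (((hr.sub_const η).clog_real hm).sub ((hr.add_const η).clog_real hp)).const_mul η
  have d2 := (Complex.imCLM.hasFDerivAt.comp_hasDerivAt r d).div_const π
  refine d2.congr_deriv ?_
  congr 1
  simp only [Complex.imCLM_apply, Complex.ofRealCLM_apply]
  congr 1
  have n1 := Complex.slitPlane_ne_zero hm
  have n2 := Complex.slitPlane_ne_zero hp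
  have : (r : ℂ) ^ 2 - η ^ 2 = (r - η) * (r + η) := by ring
  rw [this]
  field_simp
  ring

lemma stieltjes_kernel {φ x g y : ℝ} (h0 : 0 < φ) (h1 : φ < π) (hx : 0 < x) (hy : g < y) :
    (2 * (x * Complex.exp (φ * Complex.I) - g : ℂ) /
      ((√(y - g) : ℝ) ^ 2 - (x * Complex.exp (φ * Complex.I) - g))).im / π *
      (1 / (2 * √(y - g))) = kerAngle φ x y * √(y - g) := by
  have hq := kerQuad_pos h0 h1 hx y
  have hs : 0 < √(y - g) := Real.sqrt_pos.2 (by linarith)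
  have hs2 : √(y - g) ^ 2 = y - g := Real.sq_sqrt (by linarith)
  rw [← Complex.ofReal_pow, hs2, Complex.exp_mul_I, ← Complex.ofReal_cos, ← Complex.ofReal_sin]
  have hq' : (y - x * Real.cos φ) * (y - x * Real.cos φ) + x * Real.sin φ * (x * Real.sin φ)
      = kerQuad φ x y := by
    unfold kerQuad
    linear_combination x ^ 2 * (Real.sin_sq_add_cos_sq φ)
  rw [Complex.div_im]
  simp [Complex.normSq_apply, -Complex.ofReal_cos, -Complex.ofReal_sin]
  rw [hq']
  unfold kerAngle
  field_simp
  rw [hs2]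
  ring

lemma stieltjes_sqrt {φ x g : ℝ} (h0 : 0 < φ) (h1 : φ < π) (hx : 0 < x) :
    IntegrableOn (fun y => kerAngle φ x y * √(y - g)) (Ioi g) ∧
    ∫ y in Ioi g, kerAngle φ x y * √(y - g) =
      (((x * Complex.exp (φ * Complex.I) - g : ℂ)) ^ (2⁻¹ : ℂ)).re := by
  set ζ : ℂ := x * Complex.exp (φ * Complex.I) - g with hζ
  set η : ℂ := ζ ^ (2⁻¹ : ℂ) with hη
  have hζi : 0 < ζ.im := by
    rw [hζ, Complex.exp_mul_I, ← Complex.ofReal_cos, ← Complex.ofReal_sin]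
    simpa [-Complex.ofReal_cos, -Complex.ofReal_sin] using mul_pos hx (Real.sin_pos_of_pos_of_lt_pi h0 h1)
  have hηi : 0 < η.im := csqrt_im_pos hζi
  have hη2 : η ^ 2 = ζ := csqrt_sq ζ
  have hc : ContinuousWithinAt (fun y => stieltjesPrim η √(y - g)) (Ici g) g := by
    have : Continuous (stieltjesPrim η) :=
      continuous_iff_continuousAt.2 fun r => (hasDerivAt_stieltjesPrim hηi r).continuousAt
    exact (this.comp (by fun_prop)).continuousWithinAt
  have hd : ∀ y ∈ Ioi g, HasDerivAt (fun y => stieltjesPrim η √(y - g))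
      (kerAngle φ x y * √(y - g)) y := by
    intro y hy
    have hy' : g < y := hy
    have d := (hasDerivAt_stieltjesPrim hηi √(y - g)).comp y
      (((hasDerivAt_id y).sub_const g).sqrt (by simp only [id]; linarith))
    refine d.congr_deriv ?_
    rw [← stieltjes_kernel h0 h1 hx hy', ← hζ, hη2]
    simp
  have hl : Tendsto (fun y => stieltjesPrim η √(y - g)) atTop (𝓝 0) :=
    tendsto_stieltjesPrim.comp (Real.tendsto_sqrt_atTop.comp
      (tendsto_atTop_add_const_right _ _ tendsto_id))
  have hn : ∀ y ∈ Ioi g, 0 ≤ kerAngle φ x y * √(y - g) := fun y _ =>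
    mul_nonneg (kerAngle_pos h0 h1 hx y).le (Real.sqrt_nonneg _)
  refine ⟨integrableOn_Ioi_deriv_of_nonneg hc hd hn hl, ?_⟩
  rw [integral_Ioi_of_hasDerivAt_of_nonneg hc hd hn hl]
  simp [stieltjesPrim_zero hηi]

/-- The logarithm of the critical point of `u ↦ u ^ (2α) + u ^ (-2)`. -/
def logCrit (α : ℝ) : ℝ := -Real.log α / (2 * α + 2)

lemma exp_mul_logCrit {α : ℝ} (hα : 1 < α) : Real.exp ((2 * α + 2) * logCrit α) = 1 / α := by
  unfold logCrit
  rw [mul_div_cancel₀ _ (by linarith : (2 * α + 2) ≠ 0), Real.exp_neg, Real.exp_log (by linarith),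
    one_div]

lemma rhoC_eq {α : ℝ} (hα : 1 < α) : rhoC α = (α + 1) / α * Real.exp (-(2 * logCrit α)) := by
  unfold rhoC logCrit
  rw [Real.rpow_def_of_pos (by linarith)]
  congr 2
  have : α + 1 ≠ 0 := by linarith
  have : 2 * α + 2 ≠ 0 := by linarith
  field_simp

lemma rhoC_pos {α : ℝ} (hα : 1 < α) : 0 < rhoC α := by
  rw [rhoC_eq hα]
  have : 0 < α := by linarith
  positivity

lemma rhoC_mul_exp {α : ℝ} (hα : 1 < α) :
    rhoC α * Real.exp (2 * logCrit α) = (α + 1) / α := by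
  rw [rhoC_eq hα, mul_assoc, ← Real.exp_add]
  simp

lemma exp_two_alpha_logCrit {α : ℝ} (hα : 1 < α) :
    Real.exp (2 * α * logCrit α) = rhoC α / (α + 1) := by
  have h1 := exp_mul_logCrit hα
  have h2 := rhoC_mul_exp hα
  rw [add_mul, Real.exp_add] at h1
  have h3 := Real.exp_pos (2 * logCrit α)
  have : 0 < α := by linarith
  rw [eq_div_iff (by linarith)]
  apply mul_right_cancel₀ h3.ne'
  rw [h2, mul_right_comm, h1]
  field_simp

/-- The potential `V(e^w; x)` continued to complex `w`. -/
def Vlog (α x : ℝ) (w : ℂ) : ℂ :=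
  x * Complex.exp (2 * w) - Complex.exp ((2 * α + 2) * w) - 1

lemma Vlog_re (α x t θ : ℝ) : (Vlog α x (t + θ * Complex.I)).re =
    x * Real.exp (2 * t) * Real.cos (2 * θ) -
      Real.exp ((2 * α + 2) * t) * Real.cos ((2 * α + 2) * θ) - 1 := by
  simp [Vlog, Complex.exp_re]
  ring

lemma Vlog_im (α x t θ : ℝ) : (Vlog α x (t + θ * Complex.I)).im =
    x * Real.exp (2 * t) * Real.sin (2 * θ) -
      Real.exp ((2 * α + 2) * t) * Real.sin ((2 * α + 2) * θ) := by
  simp [Vlog, Complex.exp_im]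
  ring

lemma sin_smul_gt {l c : ℝ} (hl0 : 0 < l) (hl1 : l < 1) (hc0 : 0 < c) (hc1 : c < π) :
    l * Real.sin c < Real.sin (l * c) := by
  have := strictConcaveOn_sin_Icc.2 (left_mem_Icc.2 pi_pos.le) ⟨hc0.le, hc1.le⟩ hc0.ne
    (sub_pos.2 hl1) hl0 (by ring)
  simpa using this

lemma strip_facts {α θ : ℝ} (hα : 1 < α) (h0 : 0 < θ) (h1 : θ ≤ π / (1 + α)) :
    0 < Real.sin (2 * θ) ∧ 0 < (2 * α + 2) * θ ∧ (2 * α + 2) * θ ≤ 2 * π ∧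
    Real.sin ((2 * α + 2) * θ) ≤ (α + 1) * Real.sin (2 * θ) := by
  have hc : (2 * α + 2) * θ ≤ 2 * π := by
    rw [le_div_iff₀ (by linarith)] at h1; nlinarith
  have hb : 2 * θ < π := by
    have : 4 * θ < (2 * α + 2) * θ := by nlinarith
    linarith
  have hs := Real.sin_pos_of_pos_of_lt_pi (by linarith : 0 < 2 * θ) hb
  have hc0 : 0 < (2 * α + 2) * θ := by nlinarith
  refine ⟨hs, hc0, hc, ?_⟩
  by_cases h : (2 * α + 2) * θ < π
  · have := sin_smul_gt (l := 1 / (α + 1)) (by positivity)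
      (by rw [div_lt_one (by linarith)]; linarith) hc0 h
    have e : 1 / (α + 1) * ((2 * α + 2) * θ) = 2 * θ := by
      have : α + 1 ≠ 0 := by linarith
      field_simp
    rw [e, one_div, inv_mul_lt_iff₀ (by linarith)] at this
    exact this.le
  · push Not at h
    have : Real.sin ((2 * α + 2) * θ) ≤ 0 := by
      rw [← Real.sin_sub_two_pi]
      exact Real.sin_nonpos_of_nonpos_of_neg_pi_le (by linarith) (by linarith)
    nlinarith

lemma Vlog_mem_slitPlane {α x : ℝ} (hα : 1 < α) (hx : rhoC α ≤ x) (t : ℝ) {θ : ℝ} (h0 : 0 < θ)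
    (h1 : θ ≤ π / (1 + α)) : Vlog α x (t + θ * Complex.I) ∈ Complex.slitPlane := by
  obtain ⟨hb, hc0, hc1, -⟩ := strip_facts hα h0 h1
  have hx0 : 0 < x := lt_of_lt_of_le (rhoC_pos hα) hx
  by_cases him : (Vlog α x (t + θ * Complex.I)).im = 0
  swap
  · exact Or.inr him
  left
  rw [Vlog_im] at him
  rw [Vlog_re]
  set b := 2 * θ
  set c := (2 * α + 2) * θ with hcdef
  have hα1 : 0 < α + 1 := by linarith
  have hα0 : 0 < α := by linarith
  have hY : Real.exp ((2 * α + 2) * t) = Real.exp (2 * α * t) * Real.exp (2 * t) := by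
    rw [← Real.exp_add]; ring_nf
  have hE := Real.exp_pos (2 * t)
  have hsc : 0 < Real.sin c := by
    have : 0 < x * Real.exp (2 * t) * Real.sin b := by positivity
    by_contra hn
    push Not at hn
    nlinarith [Real.exp_pos ((2 * α + 2) * t)]
  have hcpi : c < π := by
    by_contra hn
    push Not at hn
    have : Real.sin c ≤ 0 := by
      rw [← Real.sin_sub_two_pi]
      exact Real.sin_nonpos_of_nonpos_of_neg_pi_le (by linarith) (by linarith)
    linarith
  have hsb : 1 / (α + 1) * Real.sin c < Real.sin b := by
    have := sin_smul_gt (l := 1 / (α + 1)) (by positivity)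
      (by rw [div_lt_one (by linarith)]; linarith) hc0 hcpi
    convert this using 2
    rw [hcdef]
    field_simp
    ring
  have hsa : α / (α + 1) * Real.sin c < Real.sin (c - b) := by
    have := sin_smul_gt (l := α / (α + 1)) (by positivity)
      (by rw [div_lt_one (by linarith)]; linarith) hc0 hcpi
    convert this using 2
    rw [hcdef]
    field_simp
    ring
  have hrel : x * Real.sin b = Real.exp (2 * α * t) * Real.sin c := by
    rw [hY] at him
    apply mul_left_cancel₀ hE.ne'
    linarith
  have hexp : rhoC α / (α + 1) < Real.exp (2 * α * t) := by
    have h2 : x * (1 / (α + 1) * Real.sin c) < x * Real.sin b := by gcongr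
    rw [hrel] at h2
    have h3 : x / (α + 1) < Real.exp (2 * α * t) := by
      apply lt_of_mul_lt_mul_right _ hsc.le
      calc x / (α + 1) * Real.sin c = x * (1 / (α + 1) * Real.sin c) := by ring
        _ < _ := h2
    exact lt_of_le_of_lt (by gcongr) h3
  rw [← exp_two_alpha_logCrit hα, Real.exp_lt_exp] at hexp
  have ht : logCrit α < t := lt_of_mul_lt_mul_left hexp (by positivity)
  have hX : (α + 1) / α < x * Real.exp (2 * t) := by
    rw [← rhoC_mul_exp hα]
    have := rhoC_pos hα
    calc rhoC α * Real.exp (2 * logCrit α) < rhoC α * Real.exp (2 * t) := by gcongr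
      _ ≤ _ := by gcongr
  have key : (x * Real.exp (2 * t) * Real.cos b -
      Real.exp ((2 * α + 2) * t) * Real.cos c) * Real.sin c =
      x * Real.exp (2 * t) * Real.sin (c - b) := by
    rw [Real.sin_sub]
    linear_combination Real.cos c * him
  have h4 : Real.sin c < x * Real.exp (2 * t) * Real.sin (c - b) := by
    calc Real.sin c = (α + 1) / α * (α / (α + 1) * Real.sin c) := by field_simp
      _ < (α + 1) / α * Real.sin (c - b) := by gcongr
      _ ≤ _ := by
        have : 0 < Real.sin (c - b) := lt_of_le_of_lt (by positivity) hsa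
        gcongr
  rw [← key] at h4
  have h5 : 1 < x * Real.exp (2 * t) * Real.cos b -
      Real.exp ((2 * α + 2) * t) * Real.cos c := by
    apply lt_of_mul_lt_mul_right _ hsc.le
    linarith
  linarith

/-- The principal square root of `V(e^w; x)` at `w = t + iθ`. -/
def sqrtV (α x t θ : ℝ) : ℂ := Vlog α x (t + θ * Complex.I) ^ (2⁻¹ : ℂ)

lemma sqrtV_sq (α x t θ : ℝ) : sqrtV α x t θ ^ 2 = Vlog α x (t + θ * Complex.I) := csqrt_sq _

lemma continuous_Vlog (α x : ℝ) : Continuous (Vlog α x) := by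
  unfold Vlog; fun_prop

lemma continuous_sqrtV_re (α x : ℝ) :
    Continuous fun p : ℝ × ℝ => (sqrtV α x p.2 p.1).re := by
  unfold sqrtV
  simp only [Complex.cpow_inv_two_re]
  have : Continuous fun p : ℝ × ℝ => Vlog α x (p.2 + p.1 * Complex.I) :=
    (continuous_Vlog α x).comp (by fun_prop)
  fun_prop

lemma measurable_sqrtV (α x t : ℝ) : Measurable (sqrtV α x t) := by
  unfold sqrtV
  have : Continuous fun θ : ℝ => Vlog α x (t + θ * Complex.I) :=
    (continuous_Vlog α x).comp (by fun_prop)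
  exact this.measurable.pow_const _

lemma norm_Vlog_add_one_le {α x : ℝ} (hx : 0 ≤ x) (t θ : ℝ) :
    ‖Vlog α x (t + θ * Complex.I) + 1‖ ≤
      x * Real.exp (2 * t) + Real.exp ((2 * α + 2) * t) := by
  unfold Vlog
  rw [sub_add_cancel]
  refine (norm_sub_le _ _).trans (le_of_eq ?_)
  simp [Complex.norm_exp, abs_of_nonneg hx]

lemma norm_sqrtV_le {α x : ℝ} (hx : 0 ≤ x) (t θ : ℝ) :
    ‖sqrtV α x t θ‖ ≤ x * Real.exp (2 * t) + Real.exp ((2 * α + 2) * t) + 2 := by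
  have h1 : ‖sqrtV α x t θ‖ ^ 2 ≤ x * Real.exp (2 * t) + Real.exp ((2 * α + 2) * t) + 1 := by
    rw [← norm_pow, sqrtV_sq]
    calc ‖Vlog α x (t + θ * Complex.I)‖
        = ‖(Vlog α x (t + θ * Complex.I) + 1) - 1‖ := by ring_nf
      _ ≤ ‖Vlog α x (t + θ * Complex.I) + 1‖ + ‖(1 : ℂ)‖ := norm_sub_le _ _
      _ ≤ _ := by simpa using norm_Vlog_add_one_le hx t θ
  nlinarith [sq_nonneg (‖sqrtV α x t θ‖ - 1)]

lemma intervalIntegrable_sqrtV {α x : ℝ} (hx : 0 ≤ x) (t a b : ℝ) :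
    IntervalIntegrable (sqrtV α x t) volume a b := by
  rw [intervalIntegrable_iff]
  refine Integrable.mono' (g := fun _ => x * Real.exp (2 * t) + Real.exp ((2 * α + 2) * t) + 2)
    ?_ (measurable_sqrtV α x t).aestronglyMeasurable ?_
  · exact integrableOn_const measure_Ioc_lt_top.ne
  exact ae_of_all _ fun θ => norm_sqrtV_le hx t θ

lemma rect_sqrtV {α x : ℝ} (hα : 1 < α) (hx : rhoC α ≤ x) (T : ℝ) {ε : ℝ} (hε : 0 < ε)
    (hε1 : ε ≤ π / (1 + α)) :
    (∫ t in -T..T, (sqrtV α x t ε).re) - (∫ t in -T..T, (sqrtV α x t (π / (1 + α))).re) -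
      (∫ θ in ε..(π / (1 + α)), (sqrtV α x T θ).im) +
      (∫ θ in ε..(π / (1 + α)), (sqrtV α x (-T) θ).im) = 0 := by
  have hx0 : 0 ≤ x := (rhoC_pos hα).le.trans hx
  set Θ := π / (1 + α)
  set z : ℂ := ((-T : ℝ) : ℂ) + ε * Complex.I with hz
  set w : ℂ := (T : ℂ) + Θ * Complex.I with hw
  have hzr : z.re = -T := by simp [hz]
  have hzi : z.im = ε := by simp [hz]
  have hwr : w.re = T := by simp [hw]
  have hwi : w.im = Θ := by simp [hw]
  have hslit : ∀ t θ : ℝ, θ ∈ uIcc ε Θ → Vlog α x (t + θ * Complex.I) ∈ Complex.slitPlane := by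
    intro t θ hθ
    rw [uIcc_of_le hε1] at hθ
    exact Vlog_mem_slitPlane hα hx t (hε.trans_le hθ.1) hθ.2
  have h := Complex.integral_boundary_rect_eq_zero_of_differentiableOn
    (fun w => Vlog α x w ^ (2⁻¹ : ℂ)) z w (by
      intro v hv
      rw [hzr, hzi, hwr, hwi] at hv
      have hv2 := hslit v.re v.im hv.2
      rw [Complex.re_add_im] at hv2
      have : DifferentiableAt ℂ (Vlog α x) v := by unfold Vlog; fun_prop
      exact (this.cpow_const hv2).differentiableWithinAt)
  rw [hzr, hzi, hwr, hwi] at h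
  have hc : ∀ θ ∈ uIcc ε Θ, IntervalIntegrable (fun t => sqrtV α x t θ) volume (-T) T := by
    intro θ hθ
    refine Continuous.intervalIntegrable ?_ _ _
    unfold sqrtV
    exact Continuous.cpow ((continuous_Vlog α x).comp (by fun_prop)) continuous_const
      fun t => hslit t θ hθ
  have c1 := Complex.reCLM.intervalIntegral_comp_comm (hc ε left_mem_uIcc)
  have c2 := Complex.reCLM.intervalIntegral_comp_comm (hc Θ right_mem_uIcc)
  have c3 := Complex.imCLM.intervalIntegral_comp_comm
    (intervalIntegrable_sqrtV (α := α) hx0 T ε Θ)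
  have c4 := Complex.imCLM.intervalIntegral_comp_comm
    (intervalIntegrable_sqrtV (α := α) hx0 (-T) ε Θ)
  simp only [Complex.reCLM_apply, Complex.imCLM_apply] at c1 c2 c3 c4
  rw [c1, c2, c3, c4]
  have h2 := congrArg Complex.re h
  simp only [smul_eq_mul, Complex.add_re, Complex.sub_re, Complex.mul_re, Complex.I_re,
    Complex.I_im, zero_mul, one_mul, zero_sub, Complex.zero_re] at h2
  simp only [sqrtV]
  push_cast at h2 ⊢
  linarith

lemma rect_sqrtV_zero {α x : ℝ} (hα : 1 < α) (hx : rhoC α ≤ x) (T : ℝ) :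
    (∫ t in -T..T, (sqrtV α x t 0).re) - (∫ t in -T..T, (sqrtV α x t (π / (1 + α))).re) -
      (∫ θ in 0..(π / (1 + α)), (sqrtV α x T θ).im) +
      (∫ θ in 0..(π / (1 + α)), (sqrtV α x (-T) θ).im) = 0 := by
  have hx0 : 0 ≤ x := (rhoC_pos hα).le.trans hx
  have hΘ : 0 < π / (1 + α) := by have := pi_pos; positivity
  set Θ := π / (1 + α)
  have hv : ∀ t, Tendsto (fun ε => ∫ θ in ε..Θ, (sqrtV α x t θ).im) (𝓝[>] 0)
      (𝓝 (∫ θ in 0..Θ, (sqrtV α x t θ).im)) := by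
    intro t
    have hi : IntegrableOn (fun θ => (sqrtV α x t θ).im) (uIcc 0 Θ) := by
      have := (intervalIntegrable_sqrtV (α := α) hx0 t 0 Θ)
      rw [intervalIntegrable_iff'] at this
      exact this.im
    have := intervalIntegral.continuousOn_primitive_interval_left hi 0 left_mem_uIcc
    rw [uIcc_of_le hΘ.le] at this
    exact this.mono_left (nhdsWithin_le_of_mem (Icc_mem_nhdsGT hΘ))
  have hb : Tendsto (fun ε => ∫ t in -T..T, (sqrtV α x t ε).re) (𝓝[>] 0)
      (𝓝 (∫ t in -T..T, (sqrtV α x t 0).re)) := by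
    have : Continuous fun ε => ∫ t in -T..T, (sqrtV α x t ε).re :=
      intervalIntegral.continuous_parametric_intervalIntegral_of_continuous'
        (continuous_sqrtV_re α x) _ _
    exact (this.tendsto 0).mono_left nhdsWithin_le_nhds
  have h := ((hb.sub_const (∫ t in -T..T, (sqrtV α x t Θ).re)).sub (hv T)).add (hv (-T))
  refine tendsto_nhds_unique h (tendsto_const_nhds.congr' ?_)
  filter_upwards [Ioc_mem_nhdsGT hΘ] with ε hε
  exact (rect_sqrtV hα hx T hε.1 hε.2).symm

lemma tendsto_left_side {α x : ℝ} (hα : 1 < α) (hx : rhoC α ≤ x) :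
    Tendsto (fun T => ∫ θ in 0..(π / (1 + α)), (sqrtV α x (-T) θ).im) atTop
      (𝓝 (π / (1 + α))) := by
  have hx0 : 0 < x := (rhoC_pos hα).trans_le hx
  have hΘ : 0 < π / (1 + α) := by have := pi_pos; positivity
  set Θ := π / (1 + α) with hΘdef
  have hexp : ∀ c : ℝ, 0 < c → Tendsto (fun T : ℝ => Real.exp (c * -T)) atTop (𝓝 0) := by
    intro c hc
    refine Real.tendsto_exp_atBot.comp ?_
    simp only [mul_neg]
    exact tendsto_neg_atTop_atBot.comp (tendsto_id.const_mul_atTop hc)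
  have hB : Tendsto (fun T : ℝ => (x * Real.exp (2 * -T) + Real.exp ((2 * α + 2) * -T)) * |Θ - 0|)
      atTop (𝓝 0) := by
    have := (((hexp 2 (by norm_num)).const_mul x).add
      (hexp (2 * α + 2) (by linarith))).mul_const |Θ - 0|
    simpa using this
  have hsmall : ∀ᶠ T : ℝ in atTop, Real.exp (2 * α * -T) * (α + 1) < x := by
    have := (hexp (2 * α) (by linarith)).mul_const (α + 1)
    rw [zero_mul] at this
    exact this.eventually_lt_const hx0
  rw [tendsto_iff_norm_sub_tendsto_zero]
  refine squeeze_zero' (Eventually.of_forall fun _ => norm_nonneg _) ?_ hB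
  filter_upwards [hsmall] with T hT
  have hi : IntervalIntegrable (fun θ => (sqrtV α x (-T) θ).im) volume 0 Θ := by
    have := (intervalIntegrable_sqrtV (α := α) hx0.le (-T) 0 Θ)
    rw [intervalIntegrable_iff] at this ⊢
    exact this.im
  have e : (∫ θ in 0..Θ, (sqrtV α x (-T) θ).im) - Θ =
      ∫ θ in 0..Θ, ((sqrtV α x (-T) θ).im - 1) := by
    rw [intervalIntegral.integral_sub hi (by simp)]
    simp
  rw [e]
  refine intervalIntegral.norm_integral_le_of_norm_le_const fun θ hθ => ?_
  rw [uIoc_of_le hΘ.le] at hθ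
  obtain ⟨hb, -, -, hcb⟩ := strip_facts hα hθ.1 hθ.2
  have him : 0 ≤ (Vlog α x ((-T : ℝ) + θ * Complex.I)).im := by
    rw [Vlog_im]
    have hY : Real.exp ((2 * α + 2) * -T) = Real.exp (2 * α * -T) * Real.exp (2 * -T) := by
      rw [← Real.exp_add]; ring_nf
    rw [hY]
    have h1 : Real.exp (2 * α * -T) * Real.sin ((2 * α + 2) * θ) ≤ x * Real.sin (2 * θ) := by
      calc _ ≤ Real.exp (2 * α * -T) * ((α + 1) * Real.sin (2 * θ)) := by gcongr
        _ = (Real.exp (2 * α * -T) * (α + 1)) * Real.sin (2 * θ) := by ring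
        _ ≤ _ := by gcongr
    nlinarith [Real.exp_pos (2 * -T)]
  have hH : 0 ≤ (sqrtV α x (-T) θ).im := csqrt_im_nonneg him
  set H := sqrtV α x (-T) θ
  have h1 : 1 ≤ ‖H + Complex.I‖ := by
    refine le_trans ?_ (Complex.abs_im_le_norm _)
    simp only [Complex.add_im, Complex.I_im]
    rw [abs_of_nonneg (by linarith)]
    linarith
  have h2 : ‖H - Complex.I‖ * ‖H + Complex.I‖ =
      ‖Vlog α x ((-T : ℝ) + θ * Complex.I) + 1‖ := by
    rw [← norm_mul, ← sqrtV_sq]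
    congr 1
    ring_nf
    simp [H, add_comm]
  have h3 : ‖H - Complex.I‖ ≤ ‖Vlog α x ((-T : ℝ) + θ * Complex.I) + 1‖ := by
    rw [← h2]
    exact le_mul_of_one_le_right (norm_nonneg _) h1
  calc ‖H.im - 1‖ = |(H - Complex.I).im| := by simp
    _ ≤ ‖H - Complex.I‖ := Complex.abs_im_le_norm _
    _ ≤ _ := h3.trans (norm_Vlog_add_one_le hx0.le _ _)

lemma half_norm_le_norm_add {α x T θ : ℝ} (hα : 1 < α) (hx : 0 < x)
    (hT : x < Real.exp (2 * α * T)) (h0 : 0 < θ) (h1 : θ ≤ π / (1 + α)) :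
    Real.exp ((α + 1) * T) / 2 ≤
      ‖sqrtV α x T θ + -Complex.I * Complex.exp ((α + 1) * (T + θ * Complex.I))‖ := by
  obtain ⟨hb, hc0, hc1, -⟩ := strip_facts hα h0 h1
  set E := Real.exp ((α + 1) * T) with hE
  have hEpos : 0 < E := Real.exp_pos _
  set B := -Complex.I * Complex.exp ((α + 1) * (T + θ * Complex.I)) with hB
  set H := sqrtV α x T θ with hH
  have hBr : B.re = E * Real.sin ((α + 1) * θ) := by simp [hB, hE, Complex.exp_im]
  have hBi : B.im = -(E * Real.cos ((α + 1) * θ)) := by simp [hB, hE, Complex.exp_re]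
  have hHr : 0 ≤ H.re := csqrt_re_nonneg _
  have hs : 0 ≤ Real.sin ((α + 1) * θ) :=
    Real.sin_nonneg_of_nonneg_of_le_pi (by nlinarith) (by nlinarith)
  have hBr0 : 0 ≤ B.re := by rw [hBr]; positivity
  have hY : Real.exp ((2 * α + 2) * T) = Real.exp (2 * α * T) * Real.exp (2 * T) := by
    rw [← Real.exp_add]; ring_nf
  have hE2 := Real.exp_pos (2 * T)
  have key : (0 ≤ H.im * B.im ∨ 1 / 2 ≤ Real.sin ((α + 1) * θ)) →
      E / 2 ≤ ‖H + B‖ := by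
    rintro (h | h)
    · refine le_trans (half_le_self hEpos.le) ((sq_le_sq₀ hEpos.le (norm_nonneg _)).1 ?_)
      rw [Complex.sq_norm, Complex.normSq_apply, Complex.add_re, Complex.add_im]
      have hBB : B.re * B.re + B.im * B.im = E ^ 2 := by
        rw [hBr, hBi]
        linear_combination E ^ 2 * Real.sin_sq_add_cos_sq ((α + 1) * θ)
      nlinarith [mul_nonneg hHr hBr0, mul_self_nonneg H.re, mul_self_nonneg H.im]
    · refine le_trans ?_ (Complex.re_le_norm _)
      rw [Complex.add_re, hBr]
      nlinarith
  apply key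
  rcases le_or_gt ((2 * α + 2) * θ) (π / 2) with hc | hc
  · left
    have him : (Vlog α x (T + θ * Complex.I)).im < 0 := by
      rw [Vlog_im, hY]
      have : Real.sin (2 * θ) ≤ Real.sin ((2 * α + 2) * θ) :=
        Real.sin_le_sin_of_le_of_le_pi_div_two (by linarith) hc (by nlinarith)
      have h3 : x * Real.sin (2 * θ) < Real.exp (2 * α * T) * Real.sin ((2 * α + 2) * θ) := by
        calc _ < Real.exp (2 * α * T) * Real.sin (2 * θ) := by gcongr
          _ ≤ _ := by gcongr
      nlinarith
    have h4 : H.im ≤ 0 := csqrt_im_nonpos him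
    have h5 : 0 ≤ Real.cos ((α + 1) * θ) :=
      Real.cos_nonneg_of_neg_pi_div_two_le_of_le (by nlinarith) (by nlinarith)
    refine mul_nonneg_of_nonpos_of_nonpos h4 ?_
    rw [hBi]
    have := mul_nonneg hEpos.le h5
    linarith
  rcases le_or_gt ((2 * α + 2) * θ) π with hc' | hc'
  · right
    have h6 := Real.cos_nonpos_of_pi_div_two_le_of_le hc.le (by linarith)
    have h7 : (2 * α + 2) * θ = 2 * ((α + 1) * θ) := by ring
    rw [h7, Real.cos_two_mul'] at h6
    nlinarith [Real.sin_sq_add_cos_sq ((α + 1) * θ)]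
  · left
    have h8 : Real.sin ((2 * α + 2) * θ) ≤ 0 := by
      rw [← Real.sin_sub_two_pi]
      exact Real.sin_nonpos_of_nonpos_of_neg_pi_le (by linarith) (by linarith)
    have him : 0 ≤ (Vlog α x (T + θ * Complex.I)).im := by
      rw [Vlog_im]
      have := mul_nonneg (mul_nonneg hx.le hE2.le) hb.le
      nlinarith [Real.exp_pos ((2 * α + 2) * T)]
    have h4 : 0 ≤ H.im := csqrt_im_nonneg him
    have h5 : Real.cos ((α + 1) * θ) ≤ 0 :=
      Real.cos_nonpos_of_pi_div_two_le_of_le (by linarith) (by linarith)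
    refine mul_nonneg h4 ?_
    rw [hBi]
    nlinarith

lemma tendsto_right_side {α x : ℝ} (hα : 1 < α) (hx : 0 < x) :
    Tendsto (fun T => ∫ θ in 0..(π / (1 + α)), (sqrtV α x T θ).im) atTop (𝓝 0) := by
  have hα1 : α + 1 ≠ 0 := by linarith
  have hα2 : 1 + α ≠ 0 := by linarith
  have hΘ : 0 < π / (1 + α) := by have := pi_pos; positivity
  set Θ := π / (1 + α) with hΘdef
  have hexp : ∀ c : ℝ, 0 < c → Tendsto (fun T : ℝ => Real.exp (-(c * T))) atTop (𝓝 0) := by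
    intro c hc
    refine Real.tendsto_exp_atBot.comp ?_
    exact tendsto_neg_atTop_atBot.comp (tendsto_id.const_mul_atTop hc)
  have hB : Tendsto (fun T : ℝ =>
      2 * (x * Real.exp (-((α - 1) * T)) + Real.exp (-((α + 1) * T))) * |Θ - 0|)
      atTop (𝓝 0) := by
    have := ((((hexp (α - 1) (by linarith)).const_mul x).add
      (hexp (α + 1) (by linarith))).const_mul 2).mul_const |Θ - 0|
    simpa using this
  have hlarge : ∀ᶠ T : ℝ in atTop, x < Real.exp (2 * α * T) :=
    (Real.tendsto_exp_atTop.comp (tendsto_id.const_mul_atTop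
      (by linarith : 0 < 2 * α))).eventually_gt_atTop x
  refine squeeze_zero_norm' ?_ hB
  filter_upwards [hlarge] with T hT
  have hi : IntervalIntegrable (fun θ => (sqrtV α x T θ).im) volume 0 Θ := by
    have := (intervalIntegrable_sqrtV (α := α) hx.le T 0 Θ)
    rw [intervalIntegrable_iff] at this ⊢
    exact this.im
  set E := Real.exp ((α + 1) * T) with hE
  have hEpos : 0 < E := Real.exp_pos _
  have hzero : ∫ θ in 0..Θ, -(E * Real.cos ((α + 1) * θ)) = 0 := by
    rw [intervalIntegral.integral_neg, intervalIntegral.integral_const_mul,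
      intervalIntegral.integral_comp_mul_left _ hα1, integral_cos]
    have : (α + 1) * Θ = π := by rw [hΘdef]; field_simp; ring
    simp [this]
  have e : (∫ θ in 0..Θ, (sqrtV α x T θ).im) =
      ∫ θ in 0..Θ, ((sqrtV α x T θ).im - -(E * Real.cos ((α + 1) * θ))) := by
    rw [intervalIntegral.integral_sub hi (Continuous.intervalIntegrable (by fun_prop) _ _), hzero,
      sub_zero]
  rw [e]
  refine intervalIntegral.norm_integral_le_of_norm_le_const fun θ hθ => ?_
  rw [uIoc_of_le hΘ.le] at hθ
  have hlow := half_norm_le_norm_add hα hx hT hθ.1 hθ.2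
  set B := -Complex.I * Complex.exp ((α + 1) * (T + θ * Complex.I)) with hBdef
  set H := sqrtV α x T θ with hH
  have hBi : B.im = -(E * Real.cos ((α + 1) * θ)) := by simp [hBdef, hE, Complex.exp_re]
  have h2 : ‖H - B‖ * ‖H + B‖ ≤ x * Real.exp (2 * T) + 1 := by
    rw [← norm_mul]
    have h3 : (H - B) * (H + B) = x * Complex.exp (2 * (T + θ * Complex.I)) - 1 := by
      have h4 : H ^ 2 = Vlog α x (T + θ * Complex.I) := sqrtV_sq _ _ _ _
      have h5 : B ^ 2 = -Complex.exp ((2 * α + 2) * (T + θ * Complex.I)) := by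
        rw [hBdef, mul_pow, ← Complex.exp_nat_mul]
        simp
        ring_nf
      have h6 : (H - B) * (H + B) = H ^ 2 - B ^ 2 := by ring
      rw [h6, h4, h5, Vlog]
      ring
    rw [h3]
    refine (norm_sub_le _ _).trans (le_of_eq ?_)
    simp [Complex.norm_exp, abs_of_pos hx]
  have h7 : ‖H - B‖ * (E / 2) ≤ x * Real.exp (2 * T) + 1 :=
    (mul_le_mul_of_nonneg_left hlow (norm_nonneg _)).trans h2
  rw [← hBi, ← Complex.sub_im]
  refine (Complex.abs_im_le_norm _).trans ?_
  rw [← le_div_iff₀ (by positivity)] at h7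
  refine h7.trans (le_of_eq ?_)
  have e1 : Real.exp (-((α - 1) * T)) = Real.exp (2 * T) / E := by
    rw [hE, ← Real.exp_sub]; ring_nf
  have e2 : Real.exp (-((α + 1) * T)) = 1 / E := by
    rw [hE, Real.exp_neg, one_div]
  rw [e1, e2]
  field_simp

lemma Vfun_exp (α x t : ℝ) :
    Vfun α x (Real.exp t) = x * Real.exp (2 * t) - Real.exp ((2 * α + 2) * t) - 1 := by
  unfold Vfun
  rw [← Real.exp_mul, ← Real.exp_nat_mul, mul_comm t]
  norm_num

lemma re_sqrtV_zero (α x t : ℝ) : (sqrtV α x t 0).re = √(Vfun α x (Real.exp t)) := by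
  have h : Vlog α x (t + (0 : ℝ) * Complex.I) = ((Vfun α x (Real.exp t) : ℝ) : ℂ) := by
    rw [Vfun_exp]; simp [Vlog]
  unfold sqrtV
  rw [h, Complex.cpow_inv_two_re, Complex.norm_real, Complex.ofReal_re, Real.norm_eq_abs]
  rcases le_total 0 (Vfun α x (Real.exp t)) with hv | hv
  · rw [abs_of_nonneg hv]; congr 1; ring
  · rw [abs_of_nonpos hv, Real.sqrt_eq_zero_of_nonpos hv]; simp

/-- The excess of the potential over its minimum, in the logarithmic variable centred at the
minimum. -/
def potExcess (α s : ℝ) : ℝ := Real.exp (2 * α * s) / α + Real.exp (-(2 * s)) - (α + 1) / α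

lemma Vfun_exp_logCrit_add {α : ℝ} (hα : 1 < α) (ξ s : ℝ) :
    Vfun α (rhoC α * ξ) (Real.exp (logCrit α + s)) =
      Real.exp (2 * s) * ((α + 1) / α * (ξ - 1) - potExcess α s) := by
  rw [Vfun_exp, mul_add, mul_add, Real.exp_add, Real.exp_add, exp_mul_logCrit hα]
  have h1 := rhoC_mul_exp hα
  have h2 : Real.exp (2 * s) * Real.exp (-(2 * s)) = 1 := by rw [← Real.exp_add]; simp
  have h3 : Real.exp ((2 * α + 2) * s) = Real.exp (2 * s) * Real.exp (2 * α * s) := by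
    rw [← Real.exp_add]; ring_nf
  rw [h3]
  unfold potExcess
  linear_combination ξ * Real.exp (2 * s) * h1 + h2

lemma two_mul_sq_le_potExcess {α : ℝ} (hα : 1 < α) (s : ℝ) : 2 * s ^ 2 ≤ potExcess α s := by
  have hα0 : 0 < α := by linarith
  unfold potExcess
  have key : 2 * s ^ 2 * α + (α + 1) ≤ Real.exp (2 * α * s) + α * Real.exp (-(2 * s)) := by
    rcases le_total 0 s with hs | hs
    · have h1 := Real.quadratic_le_exp_of_nonneg (x := 2 * α * s) (by positivity)
      have h2 := Real.add_one_le_exp (-(2 * s))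
      nlinarith [sq_nonneg s, mul_nonneg (mul_nonneg hα0.le (by linarith : 0 ≤ α - 1))
        (sq_nonneg s)]
    · have h1 := Real.quadratic_le_exp_of_nonneg (x := -(2 * s)) (by linarith)
      have h2 := Real.add_one_le_exp (2 * α * s)
      nlinarith
  have e : Real.exp (2 * α * s) / α + Real.exp (-(2 * s)) - (α + 1) / α =
      (Real.exp (2 * α * s) + α * Real.exp (-(2 * s)) - (α + 1)) / α := by
    field_simp
  rw [e, le_div_iff₀ hα0]
  linarith

lemma Vfun_nonpos_of_le {α x u : ℝ} (hα : 1 < α) (hx : x ≤ rhoC α) (hu : 0 < u) :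
    Vfun α x u ≤ 0 := by
  have hρ := rhoC_pos hα
  have h := Vfun_exp_logCrit_add hα (x / rhoC α) (Real.log u - logCrit α)
  rw [add_sub_cancel, Real.exp_log hu, mul_div_cancel₀ _ hρ.ne'] at h
  rw [h]
  refine mul_nonpos_of_nonneg_of_nonpos (Real.exp_pos _).le ?_
  have h1 := two_mul_sq_le_potExcess hα (Real.log u - logCrit α)
  have h2 : x / rhoC α ≤ 1 := by rwa [div_le_one hρ]
  have h3 : (α + 1) / α * (x / rhoC α - 1) ≤ 0 :=
    mul_nonpos_of_nonneg_of_nonpos (by positivity) (by linarith)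
  nlinarith [sq_nonneg (Real.log u - logCrit α)]

lemma Vfun_pos_crit {α x : ℝ} (hα : 1 < α) (hx : rhoC α < x) :
    0 < Vfun α x (Real.exp (logCrit α)) := by
  have hρ := rhoC_pos hα
  have h := Vfun_exp_logCrit_add hα (x / rhoC α) 0
  rw [add_zero, mul_div_cancel₀ _ hρ.ne'] at h
  rw [h]
  have h0 : potExcess α 0 = 0 := by
    unfold potExcess
    have : α ≠ 0 := by linarith
    simp
    field_simp
    ring
  rw [h0]
  have h2 : 1 < x / rhoC α := by rwa [one_lt_div hρ]
  simp only [mul_zero, Real.exp_zero, one_mul, sub_zero]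
  exact mul_pos (by positivity) (by linarith)

lemma continuous_Vfun {α : ℝ} (hα : 1 < α) (x : ℝ) : Continuous (Vfun α x) := by
  unfold Vfun
  have := Real.continuous_rpow_const (q := 2 * α + 2) (by linarith)
  fun_prop

lemma Vfun_neg_of_mul_sq_le {α x u : ℝ} (hu : 0 < u) (h : x * u ^ 2 ≤ 1) : Vfun α x u < 0 := by
  unfold Vfun
  have := Real.rpow_pos_of_pos hu (2 * α + 2)
  linarith

lemma Vfun_neg_of_le_rpow {α x u : ℝ} (hu : 0 < u) (h : x ≤ u ^ (2 * α)) : Vfun α x u < 0 := by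
  unfold Vfun
  rw [Real.rpow_add hu, Real.rpow_two]
  nlinarith [mul_le_mul_of_nonneg_right h (sq_nonneg u)]

lemma exists_bounds {α : ℝ} (hα : 1 < α) (x : ℝ) :
    ∃ a b : ℝ, 0 < a ∧ a ≤ b ∧ ∀ u, 0 < u → u ∉ Icc a b → Vfun α x u < 0 := by
  have ht : Tendsto (fun u : ℝ => u ^ (2 * α)) atTop atTop := tendsto_rpow_atTop (by linarith)
  have h0 : Tendsto (fun u : ℝ => x * u ^ 2) (𝓝[>] 0) (𝓝 0) := by
    have : Continuous fun u : ℝ => x * u ^ 2 := by fun_prop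
    have := this.tendsto 0
    simp only [ne_eq, OfNat.ofNat_ne_zero, not_false_eq_true, zero_pow, mul_zero] at this
    exact this.mono_left nhdsWithin_le_nhds
  obtain ⟨b, hb⟩ := (ht.eventually_ge_atTop x).exists_forall_of_atTop
  obtain ⟨a, ha0, ha⟩ := mem_nhdsGT_iff_exists_Ioo_subset.1 (h0.eventually_lt_const one_pos)
  refine ⟨a, max a b, ha0, le_max_left _ _, fun u hu hn => ?_⟩
  by_cases hua : u < a
  · exact Vfun_neg_of_mul_sq_le hu (le_of_lt (ha ⟨hu, hua⟩))
  · push Not at hua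
    have : max a b < u := by
      by_contra hh
      push Not at hh
      exact hn ⟨hua, hh⟩
    exact Vfun_neg_of_le_rpow hu (hb u ((le_max_right _ _).trans this.le))

lemma integrable_sqrt_Vfun_exp {α : ℝ} (hα : 1 < α) (x : ℝ) :
    Integrable fun t => √(Vfun α x (Real.exp t)) := by
  obtain ⟨a, b, ha, hab, h⟩ := exists_bounds hα x
  refine Continuous.integrable_of_hasCompactSupport
    ((continuous_Vfun hα x).comp Real.continuous_exp).sqrt ?_
  refine HasCompactSupport.intro (isCompact_Icc (a := Real.log a) (b := Real.log b)) fun t ht => ?_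
  refine Real.sqrt_eq_zero_of_nonpos (h _ (Real.exp_pos t) fun hm => ht ?_).le
  refine ⟨?_, ?_⟩
  · rw [← Real.log_exp t]; exact Real.log_le_log ha hm.1
  · rw [← Real.log_exp t]; exact Real.log_le_log (Real.exp_pos t) hm.2

lemma integral_exp_eq (f : ℝ → ℝ) : ∫ t, f (Real.exp t) = ∫ u in Ioi 0, f u / u := by
  have h := integral_image_eq_integral_abs_deriv_smul (s := univ) (f := Real.exp)
    MeasurableSet.univ (fun x _ => (Real.hasDerivAt_exp x).hasDerivWithinAt)
    Real.exp_injective.injOn (fun u => f u / u)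
  rw [image_univ, Real.range_exp] at h
  rw [h, Measure.restrict_univ]
  refine integral_congr_ae (ae_of_all _ fun t => ?_)
  simp only [abs_of_pos (Real.exp_pos t), smul_eq_mul]
  field_simp

lemma integral_roots_eq {α x : ℝ} (hα : 1 < α) (hx : rhoC α < x) :
    ∫ u in u1F α x..u2F α x, √(Vfun α x u) / u = ∫ u in Ioi 0, √(Vfun α x u) / u := by
  obtain ⟨a, b, ha, hab, h⟩ := exists_bounds hα x
  set c := Real.exp (logCrit α) with hc
  have hc0 : 0 < c := Real.exp_pos _
  have hVc : 0 < Vfun α x c := Vfun_pos_crit hα hx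
  set Z := {u : ℝ | 0 < u ∧ Vfun α x u = 0} with hZ
  have hZsub : Z ⊆ Icc a b := by
    rintro u ⟨hu, hu0⟩
    by_contra hn
    exact (h u hu hn).ne hu0
  have hcab : c ∈ Icc a b := by
    by_contra hn
    exact (h c hc0 hn).not_gt hVc
  have hbelow : BddBelow Z := ⟨a, fun u hu => (hZsub hu).1⟩
  have habove : BddAbove Z := ⟨b, fun u hu => (hZsub hu).2⟩
  have hroot_left : ∀ v, 0 < v → 0 < Vfun α x v → ∃ z ∈ Z, z < v := by
    intro v hv hVv
    have hmin : 0 < min a v / 2 := by positivity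
    have hlt : min a v / 2 < a := by
      have := min_le_left a v; linarith
    have hlt' : min a v / 2 < v := by
      have := min_le_right a v; linarith
    have hneg := h (min a v / 2) hmin fun hm => absurd hm.1 (not_le.2 hlt)
    obtain ⟨z, hz, hz0⟩ := intermediate_value_Icc hlt'.le (continuous_Vfun hα x).continuousOn
      ⟨hneg.le, hVv.le⟩
    refine ⟨z, ⟨hmin.trans_le hz.1, hz0⟩, lt_of_le_of_ne hz.2 ?_⟩
    rintro rfl
    exact hVv.ne' hz0
  have hroot_right : ∀ v, 0 < v → 0 < Vfun α x v → ∃ z ∈ Z, v < z := by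
    intro v hv hVv
    have hlt : b < max b v + 1 := by
      have := le_max_left b v; linarith
    have hlt' : v < max b v + 1 := by
      have := le_max_right b v; linarith
    have hneg := h (max b v + 1) (hv.trans hlt') fun hm => absurd hm.2 (not_le.2 hlt)
    obtain ⟨z, hz, hz0⟩ := intermediate_value_Icc' hlt'.le (continuous_Vfun hα x).continuousOn
      ⟨hneg.le, hVv.le⟩
    refine ⟨z, ⟨hv.trans_le hz.1, hz0⟩, lt_of_le_of_ne hz.1 ?_⟩
    rintro rfl
    exact hVv.ne' hz0
  obtain ⟨z, hz, -⟩ := hroot_left c hc0 hVc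
  have h12 : u1F α x ≤ u2F α x := (csInf_le hbelow hz).trans (le_csSup habove hz)
  have h1pos : 0 < u1F α x := ha.trans_le (le_csInf ⟨z, hz⟩ fun u hu => (hZsub hu).1)
  rw [intervalIntegral.integral_of_le h12]
  symm
  refine setIntegral_eq_of_subset_of_forall_sdiff_eq_zero measurableSet_Ioi
    (fun u hu => h1pos.trans hu.1) fun u hu => ?_
  have hu0 : 0 < u := hu.1
  suffices Vfun α x u ≤ 0 by rw [Real.sqrt_eq_zero_of_nonpos this, zero_div]
  by_contra hn
  push Not at hn
  obtain ⟨z1, hz1, hz1u⟩ := hroot_left u hu0 hn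
  obtain ⟨z2, hz2, hz2u⟩ := hroot_right u hu0 hn
  exact hu.2 ⟨(csInf_le hbelow hz1).trans_lt hz1u, hz2u.le.trans (le_csSup habove hz2)⟩

lemma Sfun_eq {α : ℝ} (hα : 1 < α) (x : ℝ) :
    Sfun α x = (1 / π) * ∫ t, √(Vfun α x (Real.exp t)) := by
  unfold Sfun
  split_ifs with hx
  · rw [integral_roots_eq hα hx, integral_exp_eq (fun u => √(Vfun α x u))]
  · push Not at hx
    simp [Real.sqrt_eq_zero_of_nonpos (Vfun_nonpos_of_le hα hx (Real.exp_pos _))]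

lemma tendsto_integral_symm {f : ℝ → ℝ} (hf : Integrable f) :
    Tendsto (fun T => ∫ t in -T..T, f t) atTop (𝓝 (∫ t, f t)) :=
  intervalIntegral_tendsto_integral hf tendsto_neg_atTop_atBot tendsto_id

lemma integral_eq_of_tendsto_symm {f : ℝ → ℝ} {c : ℝ} (hf : Continuous f) (h0 : ∀ t, 0 ≤ f t)
    (h : Tendsto (fun T => ∫ t in -T..T, f t) atTop (𝓝 c)) :
    Integrable f ∧ ∫ t, f t = c := by
  have hint : Integrable f := by
    refine integrable_of_intervalIntegral_norm_tendsto c (a := fun T : ℝ => -T) (b := id)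
      (fun i => hf.integrableOn_Ioc) tendsto_neg_atTop_atBot tendsto_id (h.congr fun T => ?_)
    exact intervalIntegral.integral_congr fun t _ => (Real.norm_of_nonneg (h0 t)).symm
  exact ⟨hint, tendsto_nhds_unique (tendsto_integral_symm hint) h⟩

lemma continuous_sqrtV_line (α x θ : ℝ) : Continuous fun t => (sqrtV α x t θ).re := by
  have h := continuous_sqrtV_re α x
  generalize sqrtV α x = f at h ⊢
  exact h.comp (by fun_prop : Continuous fun t : ℝ => (θ, t))

lemma integral_sqrtV_bottom {α x : ℝ} (hα : 1 < α) :
    Tendsto (fun T => ∫ t in -T..T, (sqrtV α x t 0).re) atTop (𝓝 (π * Sfun α x)) := by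
  have hS : π * Sfun α x = ∫ t, √(Vfun α x (Real.exp t)) := by
    rw [Sfun_eq hα]
    have := pi_pos
    field_simp
  rw [hS]
  simp only [re_sqrtV_zero]
  exact tendsto_integral_symm (integrable_sqrt_Vfun_exp hα x)

lemma integral_sqrtV_top {α x : ℝ} (hα : 1 < α) (hx : rhoC α ≤ x) :
    Integrable (fun t => (sqrtV α x t (π / (1 + α))).re) ∧
    ∫ t, (sqrtV α x t (π / (1 + α))).re = π * Sfun α x + π / (1 + α) := by
  have hx0 : 0 < x := (rhoC_pos hα).trans_le hx
  refine integral_eq_of_tendsto_symm (continuous_sqrtV_line α x _)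
    (fun t => csqrt_re_nonneg _) ?_
  have := ((integral_sqrtV_bottom hα (x := x)).sub (tendsto_right_side hα hx0)).add
    (tendsto_left_side hα hx)
  rw [sub_zero] at this
  refine this.congr fun T => ?_
  have := rect_sqrtV_zero hα hx T
  linarith

/-- The potential whose level set at height `y` bounds the region `V(e^t; y) > 0`. -/
def pot (α t : ℝ) : ℝ := Real.exp (2 * α * t) + Real.exp (-(2 * t))

lemma pot_pos (α t : ℝ) : 0 < pot α t := by unfold pot; positivity

lemma Vfun_exp_eq_pot (α y t : ℝ) :
    Vfun α y (Real.exp t) = Real.exp t ^ 2 * (y - pot α t) := by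
  have h1 : Real.exp t ^ 2 = Real.exp (2 * t) := by rw [← Real.exp_nat_mul]; norm_num
  have h2 : Real.exp (2 * t) * Real.exp (2 * α * t) = Real.exp ((2 * α + 2) * t) := by
    rw [← Real.exp_add]; ring_nf
  have h3 : Real.exp (2 * t) * Real.exp (-(2 * t)) = 1 := by
    rw [← Real.exp_add]; simp
  rw [Vfun_exp, h1, pot, mul_sub, mul_add, h2, h3]
  ring

lemma sqrt_Vfun_exp (α y t : ℝ) :
    √(Vfun α y (Real.exp t)) = Real.exp t * √(y - pot α t) := by
  rw [Vfun_exp_eq_pot, Real.sqrt_mul (by positivity), Real.sqrt_sq (Real.exp_pos t).le]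

lemma csqrt_re_sq_mul {r : ℝ} (hr : 0 ≤ r) (z : ℂ) :
    (((r ^ 2 : ℝ) * z : ℂ) ^ (2⁻¹ : ℂ)).re = r * (z ^ (2⁻¹ : ℂ)).re := by
  rw [Complex.cpow_inv_two_re, Complex.cpow_inv_two_re, norm_mul, Complex.re_ofReal_mul,
    Complex.norm_real, Real.norm_of_nonneg (by positivity), ← mul_add, mul_div_assoc,
    Real.sqrt_mul (by positivity), Real.sqrt_sq hr]

lemma Vlog_top {α : ℝ} (hα : 1 < α) (x t : ℝ) :
    Vlog α x (t + (π / (1 + α) : ℝ) * Complex.I) =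
      ((Real.exp t ^ 2 : ℝ) : ℂ) *
        (x * Complex.exp ((2 * π / (1 + α) : ℝ) * Complex.I) - (pot α t : ℝ)) := by
  have h1 : Complex.exp (2 * (t + (π / (1 + α) : ℝ) * Complex.I)) =
      ((Real.exp t ^ 2 : ℝ) : ℂ) * Complex.exp ((2 * π / (1 + α) : ℝ) * Complex.I) := by
    push_cast
    rw [← Complex.exp_nat_mul, ← Complex.exp_add]
    congr 1
    push_cast
    ring
  have h2 : Complex.exp ((2 * α + 2) * (t + (π / (1 + α) : ℝ) * Complex.I)) =
      (Real.exp ((2 * α + 2) * t) : ℝ) := by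
    have hne : (1 + α : ℂ) ≠ 0 := by
      have : (1 + α : ℝ) ≠ 0 := by linarith
      exact_mod_cast this
    have : (2 * α + 2 : ℂ) * (t + (π / (1 + α) : ℝ) * Complex.I) =
        (2 * α + 2) * t + 2 * π * Complex.I := by
      push_cast
      field_simp
      ring
    rw [this, Complex.exp_add, Complex.exp_two_pi_mul_I, mul_one]
    push_cast
    rfl
  have h3 := Vfun_exp_eq_pot α 0 t
  rw [Vfun_exp] at h3
  have h4 : Real.exp ((2 * α + 2) * t) + 1 = Real.exp t ^ 2 * pot α t := by linarith
  unfold Vlog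
  rw [h1, h2, sub_sub, mul_sub, mul_left_comm]
  congr 1
  rw [← Complex.ofReal_mul, ← h4]
  push_cast
  rfl

lemma angle_pos {α : ℝ} (hα : 1 < α) : 0 < 2 * π / (1 + α) := by
  have := pi_pos; positivity

lemma angle_lt {α : ℝ} (hα : 1 < α) : 2 * π / (1 + α) < π := by
  rw [div_lt_iff₀ (by linarith)]
  nlinarith [pi_pos]

lemma integral_kerAngle_mul_sqrt_Vfun {α x : ℝ} (hα : 1 < α) (hx : 0 < x) (t : ℝ) :
    IntegrableOn (fun y => kerAngle (2 * π / (1 + α)) x y * √(Vfun α y (Real.exp t))) (Ioi 0) ∧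
    ∫ y in Ioi 0, kerAngle (2 * π / (1 + α)) x y * √(Vfun α y (Real.exp t)) =
      (sqrtV α x t (π / (1 + α))).re := by
  obtain ⟨hi, he⟩ := stieltjes_sqrt (g := pot α t) (angle_pos hα) (angle_lt hα) hx
  have hz : ∀ y ∈ Ioi (0 : ℝ) \ Ioi (pot α t),
      Real.exp t * (kerAngle (2 * π / (1 + α)) x y * √(y - pot α t)) = 0 := by
    rintro y ⟨-, hy⟩
    rw [mem_Ioi, not_lt] at hy
    rw [Real.sqrt_eq_zero_of_nonpos (by linarith)]
    ring
  have hsub : Ioi (pot α t) ⊆ Ioi (0 : ℝ) := Ioi_subset_Ioi (pot_pos α t).le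
  simp only [sqrt_Vfun_exp, mul_left_comm _ (Real.exp t)]
  have hi' : IntegrableOn (fun y => Real.exp t * (kerAngle (2 * π / (1 + α)) x y *
    √(y - pot α t))) (Ioi (pot α t)) := hi.const_mul _
  refine ⟨hi'.of_forall_sdiff_eq_zero measurableSet_Ioi hz, ?_⟩
  rw [setIntegral_eq_of_subset_of_forall_sdiff_eq_zero measurableSet_Ioi hsub hz,
    integral_const_mul, he, sqrtV, Vlog_top hα, csqrt_re_sq_mul (Real.exp_pos t).le]

lemma continuous_pot (α : ℝ) : Continuous (pot α) := by unfold pot; fun_prop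

lemma integral_kerAngle_mul_Sfun {α x : ℝ} (hα : 1 < α) (hx : rhoC α ≤ x) :
    IntegrableOn (fun y => kerAngle (2 * π / (1 + α)) x y * Sfun α y) (Ioi 0) ∧
    ∫ y in Ioi 0, kerAngle (2 * π / (1 + α)) x y * Sfun α y = Sfun α x + 1 / (1 + α) := by
  have hx0 : 0 < x := (rhoC_pos hα).trans_le hx
  set φ := 2 * π / (1 + α) with hφ
  have h0 : 0 < φ := angle_pos hα
  have h1 : φ < π := angle_lt hα
  set F : ℝ × ℝ → ℝ := fun z => kerAngle φ x z.2 * √(Vfun α z.2 (Real.exp z.1)) with hF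
  have hFc : Continuous F := by
    simp only [hF, sqrt_Vfun_exp]
    have : Continuous fun z : ℝ × ℝ => kerAngle φ x z.2 :=
      (continuous_kerAngle h0 h1 hx0).comp continuous_snd
    have h2 : Continuous fun z : ℝ × ℝ => pot α z.1 := (continuous_pot α).comp continuous_fst
    fun_prop
  have hF0 : ∀ z, 0 ≤ F z := fun z =>
    mul_nonneg (kerAngle_pos h0 h1 hx0 _).le (Real.sqrt_nonneg _)
  have hin := fun t => integral_kerAngle_mul_sqrt_Vfun hα hx0 t
  obtain ⟨hti, hte⟩ := integral_sqrtV_top hα hx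
  have hFi : Integrable F (volume.prod (volume.restrict (Ioi 0))) := by
    rw [integrable_prod_iff hFc.aestronglyMeasurable]
    refine ⟨ae_of_all _ fun t => (hin t).1, ?_⟩
    refine hti.congr (ae_of_all _ fun t => ?_)
    simp only [Real.norm_of_nonneg (hF0 _)]
    exact (hin t).2.symm
  have hS : ∀ y, ∫ t, F (t, y) = π * (kerAngle φ x y * Sfun α y) := by
    intro y
    simp only [hF, integral_const_mul, Sfun_eq hα y]
    have := pi_pos
    field_simp
  have hSi := hFi.integral_prod_right
  have hsw := integral_integral_swap (f := fun t y => F (t, y)) hFi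
  simp only [hS] at hSi hsw
  have hpi := pi_pos
  refine ⟨by simpa [hpi.ne', IntegrableOn] using hSi.const_mul π⁻¹, ?_⟩
  have he : ∫ t, ∫ y in Ioi 0, F (t, y) = π * Sfun α x + π / (1 + α) := by
    rw [← hte]
    exact integral_congr_ae (ae_of_all _ fun t => (hin t).2)
  rw [he, integral_const_mul] at hsw
  have h4 : π * (∫ y in Ioi 0, kerAngle φ x y * Sfun α y) = π * (Sfun α x + 1 / (1 + α)) := by
    rw [← hsw]; ring
  exact mul_left_cancel₀ hpi.ne' h4

lemma Sfun_exp {α : ℝ} (hα : 1 < α) (L : ℝ) :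
    π * Sfun α (Real.exp L) = Real.exp ((1 + α) / (2 * α) * L) *
      ∫ s, √(Real.exp (2 * s) - Real.exp ((2 * α + 2) * s) -
        Real.exp (-((1 + α) / α * L))) := by
  have hα0 : α ≠ 0 := by linarith
  have hpi := pi_pos
  rw [Sfun_eq hα, ← integral_add_right_eq_self _ (L / (2 * α)), ← mul_assoc,
    mul_one_div_cancel hpi.ne', one_mul, ← integral_const_mul]
  refine integral_congr_ae (ae_of_all _ fun s => ?_)
  simp only
  rw [Vfun_exp]
  have h : Real.exp L * Real.exp (2 * (s + L / (2 * α))) -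
      Real.exp ((2 * α + 2) * (s + L / (2 * α))) - 1 =
      Real.exp ((1 + α) / (2 * α) * L) ^ 2 *
        (Real.exp (2 * s) - Real.exp ((2 * α + 2) * s) - Real.exp (-((1 + α) / α * L))) := by
    rw [← Real.exp_add, ← Real.exp_nat_mul, mul_sub, mul_sub, ← Real.exp_add, ← Real.exp_add,
      ← Real.exp_add]
    congr 1
    · congr 1 <;> · congr 1; push_cast; field_simp; ring
    · rw [← Real.exp_zero]; congr 1; push_cast; field_simp; ring
  rw [h, Real.sqrt_mul (by positivity), Real.sqrt_sq (Real.exp_pos _).le]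

lemma sqrt_wave_le {α : ℝ} (hα : 1 < α) {ε : ℝ} (hε : 0 ≤ ε) (s : ℝ) :
    √(Real.exp (2 * s) - Real.exp ((2 * α + 2) * s) - ε) ≤ (Iic 0).indicator Real.exp s := by
  by_cases hs : s ≤ 0
  · rw [indicator_of_mem (by exact hs)]
    refine Real.sqrt_le_iff.2 ⟨(Real.exp_pos s).le, ?_⟩
    rw [← Real.exp_nat_mul]
    push_cast
    have := Real.exp_pos ((2 * α + 2) * s)
    linarith
  · rw [indicator_of_notMem (by exact hs)]
    push Not at hs
    refine (Real.sqrt_eq_zero_of_nonpos ?_).le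
    have : Real.exp (2 * s) ≤ Real.exp ((2 * α + 2) * s) := Real.exp_le_exp.2 (by nlinarith)
    linarith

lemma integrable_indicator_exp : Integrable ((Iic (0 : ℝ)).indicator Real.exp) :=
  (integrable_indicator_iff measurableSet_Iic).2 (integrableOn_exp_Iic 0)

lemma integral_beta {a : ℝ} (ha : 0 < a) :
    ∫ v in Ioi 0, v ^ a * √(1 - v) / v =
      Real.Gamma a * Real.Gamma (3 / 2) / Real.Gamma (a + 3 / 2) := by
  have h := ProbabilityTheory.beta_eq_betaIntegralReal a (3 / 2) ha (by norm_num)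
  rw [ProbabilityTheory.beta] at h
  rw [h, Complex.betaIntegral, intervalIntegral.integral_of_le zero_le_one]
  rw [setIntegral_eq_of_subset_of_forall_sdiff_eq_zero (s := Ioc 0 1) measurableSet_Ioi
    (fun v hv => hv.1)]
  · have hc := Complex.betaIntegral_convergent (u := a) (v := (3 / 2 : ℝ)) (by simpa)
      (by norm_num)
    rw [intervalIntegrable_iff_integrableOn_Ioc_of_le zero_le_one] at hc
    have h2 := integral_re hc
    simp only [RCLike.re_eq_complex_re] at h2
    rw [← h2]
    refine setIntegral_congr_fun measurableSet_Ioc fun v hv => ?_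
    have h1v : 0 ≤ 1 - v := by linarith [hv.2]
    rw [show (1 - v : ℂ) = ((1 - v : ℝ) : ℂ) by push_cast; rfl,
      show (a - 1 : ℂ) = ((a - 1 : ℝ) : ℂ) by push_cast; rfl,
      show (((3 / 2 : ℝ) : ℂ) - 1 : ℂ) = ((1 / 2 : ℝ) : ℂ) by push_cast; norm_num,
      ← Complex.ofReal_cpow hv.1.le, ← Complex.ofReal_cpow h1v, ← Complex.ofReal_mul,
      Complex.ofReal_re, ← Real.sqrt_eq_rpow, Real.rpow_sub_one hv.1.ne']
    ring
  · rintro v ⟨hv0, hv⟩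
    have : 1 - v ≤ 0 := by
      by_contra hh
      exact hv ⟨hv0, by linarith⟩
    simp [Real.sqrt_eq_zero_of_nonpos this]

lemma integral_wave {α : ℝ} (hα : 1 < α) :
    ∫ s, √(Real.exp (2 * s) - Real.exp ((2 * α + 2) * s)) =
      √π / (2 * (1 + α)) * (Real.Gamma (1 / (2 * α)) / Real.Gamma ((1 + α) / (2 * α))) := by
  have hα0 : 0 < α := by linarith
  have h := Measure.integral_comp_mul_left
    (fun r => Real.exp r ^ (1 / (2 * α)) * √(1 - Real.exp r)) (2 * α)
  rw [integral_exp_eq (fun v => v ^ (1 / (2 * α)) * √(1 - v)),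
    integral_beta (by positivity), abs_of_pos (by positivity), smul_eq_mul] at h
  have hs : ∀ s, √(Real.exp (2 * s) - Real.exp ((2 * α + 2) * s)) =
      Real.exp (2 * α * s) ^ (1 / (2 * α)) * √(1 - Real.exp (2 * α * s)) := by
    intro s
    have h1 : Real.exp (2 * α * s) ^ (1 / (2 * α)) = Real.exp s := by
      rw [← Real.exp_mul]; congr 1; field_simp
    have h2 : Real.exp (2 * s) - Real.exp ((2 * α + 2) * s) =
        Real.exp s ^ 2 * (1 - Real.exp (2 * α * s)) := by
      rw [← Real.exp_nat_mul, mul_sub, ← Real.exp_add, mul_one]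
      congr 2
      push_cast; ring
    rw [h1, h2, Real.sqrt_mul (by positivity), Real.sqrt_sq (Real.exp_pos s).le]
  simp only [hs]
  rw [h]
  have hb : (0 : ℝ) < (1 + α) / (2 * α) := by positivity
  rw [show (3 / 2 : ℝ) = 1 / 2 + 1 by norm_num, Real.Gamma_add_one (by norm_num),
    Real.Gamma_one_half_eq,
    show 1 / (2 * α) + (1 / 2 + 1) = (1 + α) / (2 * α) + 1 by field_simp; ring,
    Real.Gamma_add_one hb.ne']
  have := Real.Gamma_pos_of_pos hb
  field_simp

lemma Aconst_rpow {α : ℝ} (hα : 1 < α) :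
    Aconst α ^ ((1 + α) / (2 * α)) = rhoC α ^ ((1 + α) / (2 * α)) / √π *
      (Real.Gamma (1 / (2 * α)) / Real.Gamma ((1 + α) / (2 * α))) := by
  have hα0 : 0 < α := by linarith
  have hpi := pi_pos
  have hg1 : 0 < Real.Gamma (1 / (2 * α)) := Real.Gamma_pos_of_pos (by positivity)
  have hg2 : 0 < Real.Gamma ((1 + α) / (2 * α)) := Real.Gamma_pos_of_pos (by positivity)
  have hR : 0 ≤ Real.Gamma (1 / (2 * α)) / (√(π * α) * Real.Gamma ((1 + α) / (2 * α))) := by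
    positivity
  unfold Aconst rhoC
  rw [Real.mul_rpow (by positivity) (by positivity), ← Real.rpow_mul hR,
    show 2 * α / (α + 1) * ((1 + α) / (2 * α)) = 1 by field_simp; ring, Real.rpow_one,
    Real.mul_rpow (by positivity) (by positivity), Real.div_rpow (by positivity) hα0.le,
    ← Real.rpow_mul hα0.le]
  have h1 : α ^ ((1 + α) / (2 * α)) = √α * α ^ (1 / (α + 1) * ((1 + α) / (2 * α))) := by
    rw [Real.sqrt_eq_rpow, ← Real.rpow_add hα0]
    congr 1
    field_simp
    ring
  have h2 : 0 < α ^ (1 / (α + 1) * ((1 + α) / (2 * α))) := by positivity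
  have h3 : 0 < √α := by positivity
  rw [h1, Real.sqrt_mul hpi.le, add_comm α 1]
  field_simp

lemma Aconst_pos {α : ℝ} (hα : 1 < α) : 0 < Aconst α := by
  have hα0 : 0 < α := by linarith
  have hpi := pi_pos
  have hg1 : 0 < Real.Gamma (1 / (2 * α)) := Real.Gamma_pos_of_pos (by positivity)
  have hg2 : 0 < Real.Gamma ((1 + α) / (2 * α)) := Real.Gamma_pos_of_pos (by positivity)
  unfold Aconst
  positivity

/-- The amplitude `∫ √(e^{2 s} - e^{(2α+2) s} - x^{-(1+α)/α}) ds`, with `x = ρξ`. -/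
def waveInt (α x : ℝ) : ℝ :=
  ∫ s, √(Real.exp (2 * s) - Real.exp ((2 * α + 2) * s) - Real.exp (-((1 + α) / α * Real.log x)))

lemma waveInt_le_one {α : ℝ} (hα : 1 < α) (x : ℝ) : waveInt α x ≤ 1 := by
  unfold waveInt
  refine (integral_mono_of_nonneg (ae_of_all _ fun s => Real.sqrt_nonneg _)
    integrable_indicator_exp (ae_of_all _ fun s => sqrt_wave_le hα (Real.exp_pos _).le s)).trans ?_
  rw [integral_indicator measurableSet_Iic, integral_exp_Iic_zero]

lemma tendsto_waveInt {α : ℝ} (hα : 1 < α) :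
    Tendsto (waveInt α) atTop
      (𝓝 (∫ s, √(Real.exp (2 * s) - Real.exp ((2 * α + 2) * s)))) := by
  unfold waveInt
  refine tendsto_integral_filter_of_dominated_convergence ((Iic 0).indicator Real.exp)
    (Eventually.of_forall fun x => ?_) (Eventually.of_forall fun x => ae_of_all _ fun s => ?_)
    integrable_indicator_exp (ae_of_all _ fun s => ?_)
  · refine Continuous.aestronglyMeasurable ?_
    fun_prop
  · rw [Real.norm_of_nonneg (Real.sqrt_nonneg _)]
    exact sqrt_wave_le hα (Real.exp_pos _).le s
  · have : Tendsto (fun x => Real.exp (-((1 + α) / α * Real.log x))) atTop (𝓝 0) := by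
      have hp : 0 < (1 + α) / α := by
        have : 0 < α := by linarith
        positivity
      exact Real.tendsto_exp_neg_atTop_nhds_zero.comp (Real.tendsto_log_atTop.const_mul_atTop hp)
    have := (this.const_sub (Real.exp (2 * s) - Real.exp ((2 * α + 2) * s))).sqrt
    rwa [sub_zero] at this

lemma tauF_eq_waveInt {α ξ : ℝ} (hα : 1 < α) (hξ : 0 < ξ) :
    tauF α ξ = 2 * (1 + α) / π * rhoC α ^ ((1 + α) / (2 * α)) * ξ ^ ((1 + α) / (2 * α)) *
      waveInt α (rhoC α * ξ) := by
  have hρ := rhoC_pos hα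
  have h := Sfun_exp hα (Real.log (rhoC α * ξ))
  rw [Real.exp_log (by positivity)] at h
  rw [mul_assoc (2 * (1 + α) / π), ← Real.mul_rpow hρ.le hξ.le, tauF, waveInt,
    Real.rpow_def_of_pos (by positivity), mul_comm (Real.log _), mul_assoc (2 * (1 + α) / π), ← h]
  have hpi := pi_pos
  field_simp

lemma tauF_nonneg {α : ℝ} (hα : 1 < α) (ξ : ℝ) : 0 ≤ tauF α ξ := by
  rw [tauF, Sfun_eq hα]
  have hpi := pi_pos
  have : 0 ≤ ∫ t, √(Vfun α (rhoC α * ξ) (Real.exp t)) :=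
    integral_nonneg fun t => Real.sqrt_nonneg _
  positivity

lemma tauF_of_le_one {α ξ : ℝ} (hα : 1 < α) (hξ : ξ ≤ 1) : tauF α ξ = 0 := by
  have : ¬ rhoC α < rhoC α * ξ := by
    have := rhoC_pos hα
    push Not
    nlinarith
  rw [tauF, Sfun, if_neg this, mul_zero]

lemma exists_tauF_le {α : ℝ} (hα : 1 < α) :
    ∃ M, 0 < M ∧ ∀ ξ, 0 < ξ → tauF α ξ ≤ M * ξ ^ ((1 + α) / (2 * α)) := by
  have hρ := rhoC_pos hα
  have hpi := pi_pos
  refine ⟨2 * (1 + α) / π * rhoC α ^ ((1 + α) / (2 * α)), by positivity, fun ξ hξ => ?_⟩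
  rw [tauF_eq_waveInt hα hξ]
  exact mul_le_of_le_one_right (by positivity) (waveInt_le_one hα _)

lemma tendsto_tauF {α : ℝ} (hα : 1 < α) :
    Tendsto (fun ξ => ξ ^ (-((1 + α) / (2 * α))) * tauF α ξ) atTop
      (𝓝 (Aconst α ^ ((1 + α) / (2 * α)))) := by
  have hρ := rhoC_pos hα
  have hpi := pi_pos
  have h := ((tendsto_waveInt hα).comp (tendsto_id.const_mul_atTop hρ)).const_mul
    (2 * (1 + α) / π * rhoC α ^ ((1 + α) / (2 * α)))
  have he : 2 * (1 + α) / π * rhoC α ^ ((1 + α) / (2 * α)) *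
      (∫ s, √(Real.exp (2 * s) - Real.exp ((2 * α + 2) * s))) =
      Aconst α ^ ((1 + α) / (2 * α)) := by
    rw [integral_wave hα, Aconst_rpow hα]
    have h1 : √π * √π = π := Real.mul_self_sqrt hpi.le
    have h2 : 0 < √π := by positivity
    have h3 : 0 < Real.Gamma ((1 + α) / (2 * α)) := Real.Gamma_pos_of_pos (by positivity)
    field_simp
    nlinarith
  rw [he] at h
  refine h.congr' ?_
  filter_upwards [eventually_gt_atTop 0] with ξ hξ
  rw [tauF_eq_waveInt hα hξ, Real.rpow_neg hξ.le]
  have : 0 < ξ ^ ((1 + α) / (2 * α)) := by positivity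
  simp only [Function.comp_apply, id]
  field_simp

/-- `f` is measurable on `(a, ∞)` and grows there at most like `y ^ β`. -/
def RpowBounded (a β : ℝ) (f : ℝ → ℝ) : Prop :=
  AEStronglyMeasurable f (volume.restrict (Ioi a)) ∧ ∃ M, 0 ≤ M ∧ ∀ y ∈ Ioi a, |f y| ≤ M * y ^ β

lemma rpowBounded_rpow {β : ℝ} (hβ : 0 < β) : RpowBounded 0 β fun y => y ^ β :=
  ⟨(Real.continuous_rpow_const hβ.le).aestronglyMeasurable, 1, zero_le_one, fun y hy => by
    rw [one_mul, abs_of_nonneg (rpow_nonneg (le_of_lt hy) _)]⟩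

section

variable {φ β a x : ℝ} {f : ℝ → ℝ}

lemma integrableOn_mul_of_le (h0 : 0 < φ) (h1 : φ < π) (hβ0 : 0 < β) (hβ1 : β < 1) (ha : 0 ≤ a)
    (hx : 0 < x) (hf : RpowBounded a β f) {q : ℝ → ℝ} {C : ℝ} (hq : Continuous q)
    (hqC : ∀ y, |q y| ≤ C * kerAngle φ x y) :
    IntegrableOn (fun y => q y * f y) (Ioi a) := by
  obtain ⟨hm, M, -, hM⟩ := hf
  have hi : IntegrableOn (fun y => C * M * (kerAngle φ x y * y ^ β)) (Ioi a) :=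
    ((integrableOn_kerAngle_mul_rpow h0 h1 hβ0 hβ1 hx).mono_set (Ioi_subset_Ioi ha)).const_mul _
  refine hi.mono' (hq.aestronglyMeasurable.mul hm) ?_
  filter_upwards [ae_restrict_mem measurableSet_Ioi] with y hy
  rw [norm_mul, Real.norm_eq_abs, Real.norm_eq_abs]
  calc |q y| * |f y| ≤ (C * kerAngle φ x y) * (M * y ^ β) :=
        mul_le_mul (hqC y) (hM y hy) (abs_nonneg _) ((abs_nonneg _).trans (hqC y))
    _ = _ := by ring

lemma integrableOn_kerAngle_mul (h0 : 0 < φ) (h1 : φ < π) (hβ0 : 0 < β) (hβ1 : β < 1) (ha : 0 ≤ a)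
    (hx : 0 < x) (hf : RpowBounded a β f) :
    IntegrableOn (fun y => kerAngle φ x y * f y) (Ioi a) :=
  integrableOn_mul_of_le (C := 1) h0 h1 hβ0 hβ1 ha hx hf (continuous_kerAngle h0 h1 hx) fun y => by
    rw [one_mul, abs_of_pos (kerAngle_pos h0 h1 hx y)]

lemma integrableOn_kerEuler_mul (h0 : 0 < φ) (h1 : φ < π) (hβ0 : 0 < β) (hβ1 : β < 1) (ha : 0 ≤ a)
    (hx : 0 < x) (hf : RpowBounded a β f) :
    IntegrableOn (fun y => kerEuler φ x y * f y) (Ioi a) :=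
  integrableOn_mul_of_le h0 h1 hβ0 hβ1 ha hx hf (continuous_kerEuler h0 h1 hx)
    (abs_kerEuler_le h0 h1 hx)

lemma kerAngle_ge (h0 : 0 < φ) (h1 : φ < π) (hx : 0 < x) (y : ℝ) :
    Real.sin φ / (2 * π) * (x / (x ^ 2 + y ^ 2)) ≤ kerAngle φ x y := by
  have hs := Real.sin_pos_of_pos_of_lt_pi h0 h1
  have hpi := pi_pos
  have hq := kerQuad_pos h0 h1 hx y
  have hq2 : kerQuad φ x y ≤ 2 * (x ^ 2 + y ^ 2) := by
    unfold kerQuad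
    have h1 : -(2 * x * y * Real.cos φ) ≤ |2 * x * y| * |Real.cos φ| := by
      rw [← abs_mul]; exact neg_le_abs _
    have h2 : |2 * x * y| ≤ x ^ 2 + y ^ 2 := by
      rw [abs_le]; constructor <;> nlinarith [sq_nonneg (x + y), sq_nonneg (x - y)]
    nlinarith [abs_nonneg (2 * x * y), Real.abs_cos_le_one φ]
  unfold kerAngle
  calc Real.sin φ / (2 * π) * (x / (x ^ 2 + y ^ 2)) =
        Real.sin φ / π * (x / (2 * (x ^ 2 + y ^ 2))) := by field_simp
    _ ≤ _ := by gcongr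

lemma exists_kerAngle_le (h0 : 0 < φ) (h1 : φ < π) (hx : 0 < x) :
    ∃ C, ∀ z ∈ Ioo (x / 2) (2 * x), ∀ y, kerAngle φ z y ≤ C * kerAngle φ x y := by
  have hs := Real.sin_pos_of_pos_of_lt_pi h0 h1
  have hpi := pi_pos
  have hc := one_sub_abs_cos_pos h0 h1
  refine ⟨(1 - |Real.cos φ|)⁻¹ * 8 * (2 * π / Real.sin φ), fun z hz y => ?_⟩
  have hz0 : 0 < z := by have := hz.1; linarith
  have hy := sq_nonneg y
  calc kerAngle φ z y ≤ (1 - |Real.cos φ|)⁻¹ * (z / (z ^ 2 + y ^ 2)) := kerAngle_le h0 h1 hz0 y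
    _ ≤ (1 - |Real.cos φ|)⁻¹ * (8 * (x / (x ^ 2 + y ^ 2))) := by
        gcongr
        rw [mul_div_assoc', div_le_div_iff₀ (by positivity) (by positivity)]
        nlinarith [hz.1, hz.2, mul_pos hz0 hx, mul_pos (sub_pos.2 hz.1) hx,
          mul_nonneg (sub_pos.2 hz.2).le hy, mul_pos (sub_pos.2 hz.1) hz0,
          mul_nonneg (sub_pos.2 hz.2).le (sq_nonneg x), mul_nonneg hx.le hy,
          mul_nonneg hx.le (mul_nonneg (sub_pos.2 hz.1).le (sub_pos.2 hz.1).le),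
          mul_pos (mul_pos (sub_pos.2 hz.1) hx) hx]
    _ = (1 - |Real.cos φ|)⁻¹ * 8 * (2 * π / Real.sin φ) *
        (Real.sin φ / (2 * π) * (x / (x ^ 2 + y ^ 2))) := by field_simp
    _ ≤ _ := by
        gcongr
        exact kerAngle_ge h0 h1 hx y

lemma hasDerivAt_integral_kerAngle (h0 : 0 < φ) (h1 : φ < π) (hβ0 : 0 < β) (hβ1 : β < 1)
    (ha : 0 ≤ a) (hx : 0 < x) (hf : RpowBounded a β f) :
    HasDerivAt (fun x => ∫ y in Ioi a, kerAngle φ x y * f y)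
      ((∫ y in Ioi a, kerEuler φ x y * f y) / x) x := by
  obtain ⟨C, hC⟩ := exists_kerAngle_le h0 h1 hx
  have hc := one_sub_abs_cos_pos h0 h1
  set D := (1 - |Real.cos φ|)⁻¹ with hD
  have hD0 : 0 < D := inv_pos.2 hc
  have hi := integrableOn_kerAngle_mul h0 h1 hβ0 hβ1 ha hx hf
  have hs : Ioo (x / 2) (2 * x) ∈ 𝓝 x := Ioo_mem_nhds (by linarith) (by linarith)
  have := (hasDerivAt_integral_of_dominated_loc_of_deriv_le
    (F := fun z y => kerAngle φ z y * f y) (F' := fun z y => kerEuler φ z y / z * f y)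
    (bound := fun y => (2 / x) * D * C * ‖kerAngle φ x y * f y‖)
    (μ := volume.restrict (Ioi a)) hs ?_ hi ?_ (ae_of_all _ fun y z hz => ?_)
    (hi.norm.const_mul _) (ae_of_all _ fun y z hz => ?_)).2
  · refine this.congr_deriv ?_
    rw [← integral_div]
    congr 1 with y
    ring
  · filter_upwards [hs] with z hz
    have hz0 : 0 < z := by have := hz.1; linarith
    exact (integrableOn_kerAngle_mul h0 h1 hβ0 hβ1 ha hz0 hf).1
  · exact ((continuous_kerEuler h0 h1 hx).div_const x).aestronglyMeasurable.mul hf.1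
  · have hz0 : 0 < z := by have := hz.1; linarith
    have hzx : z⁻¹ ≤ 2 / x := by
      rw [inv_le_comm₀ hz0 (by positivity), inv_div]; exact hz.1.le
    rw [norm_mul, norm_mul, norm_div, Real.norm_of_nonneg hz0.le, Real.norm_eq_abs,
      Real.norm_of_nonneg (kerAngle_pos h0 h1 hx y).le, ← mul_assoc]
    refine mul_le_mul_of_nonneg_right ?_ (norm_nonneg _)
    calc |kerEuler φ z y| / z ≤ D * (C * kerAngle φ x y) * (2 / x) := by
          rw [div_eq_mul_inv]
          have h2 : |kerEuler φ z y| ≤ D * (C * kerAngle φ x y) :=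
            (abs_kerEuler_le h0 h1 hz0 y).trans (mul_le_mul_of_nonneg_left (hC z hz y) hD0.le)
          exact mul_le_mul h2 hzx (inv_pos.2 hz0).le ((abs_nonneg _).trans h2)
      _ = _ := by ring
  · have hz0 : 0 < z := by have := hz.1; linarith
    exact (hasDerivAt_kerAngle h0 h1 hz0 y).mul_const _

lemma continuousAt_integral_kerEuler (h0 : 0 < φ) (h1 : φ < π) (hβ0 : 0 < β) (hβ1 : β < 1)
    (ha : 0 ≤ a) (hx : 0 < x) (hf : RpowBounded a β f) :
    ContinuousAt (fun x => ∫ y in Ioi a, kerEuler φ x y * f y) x := by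
  obtain ⟨C, hC⟩ := exists_kerAngle_le h0 h1 hx
  have hc := one_sub_abs_cos_pos h0 h1
  set D := (1 - |Real.cos φ|)⁻¹ with hD
  have hD0 : 0 < D := inv_pos.2 hc
  have hi := integrableOn_kerAngle_mul h0 h1 hβ0 hβ1 ha hx hf
  have hs : Ioo (x / 2) (2 * x) ∈ 𝓝 x := Ioo_mem_nhds (by linarith) (by linarith)
  refine MeasureTheory.continuousAt_of_dominated
    (bound := fun y => D * C * ‖kerAngle φ x y * f y‖) ?_ ?_ (hi.norm.const_mul _)
    (ae_of_all _ fun y => ?_)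
  · filter_upwards [hs] with z hz
    have hz0 : 0 < z := by have := hz.1; linarith
    exact (integrableOn_kerEuler_mul h0 h1 hβ0 hβ1 ha hz0 hf).1
  · filter_upwards [hs] with z hz
    have hz0 : 0 < z := by have := hz.1; linarith
    refine ae_of_all _ fun y => ?_
    rw [norm_mul, norm_mul, Real.norm_eq_abs, Real.norm_of_nonneg (kerAngle_pos h0 h1 hx y).le,
      ← mul_assoc]
    refine mul_le_mul_of_nonneg_right ?_ (norm_nonneg _)
    rw [mul_assoc]
    exact (abs_kerEuler_le h0 h1 hz0 y).trans (mul_le_mul_of_nonneg_left (hC z hz y) hD0.le)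
  · refine ContinuousAt.mul ?_ continuousAt_const
    have hq := kerQuad_pos h0 h1 hx y
    unfold kerEuler
    refine continuousAt_const.mul (ContinuousAt.div ?_ ?_ (pow_pos hq 2).ne')
    · fun_prop
    · unfold kerQuad; fun_prop

lemma tendsto_integral_of_homogeneous (h0 : 0 < φ) (h1 : φ < π) (hβ0 : 0 < β) (hβ1 : β < 1)
    (ha : 0 ≤ a) (hf : RpowBounded a β f) {L : ℝ}
    (hL : Tendsto (fun y => y ^ (-β) * f y) atTop (𝓝 L)) {k : ℝ → ℝ → ℝ} {C : ℝ}
    (hk : ∀ c, 0 < c → ∀ x y, k (c * x) (c * y) = c⁻¹ * k x y)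
    (hkc : ∀ x, 0 < x → Continuous (k x)) (hkC : ∀ x, 0 < x → ∀ y, |k x y| ≤ C * kerAngle φ x y) :
    Tendsto (fun x => x ^ (-β) * ∫ y in Ioi a, k x y * f y) atTop
      (𝓝 (L * ∫ t in Ioi 0, k 1 t * t ^ β)) := by
  obtain ⟨M, hM0, hM⟩ := hf.2
  set g : ℝ → ℝ := (Ioi a).indicator f with hg
  have hgM : ∀ y, 0 < y → |g y| ≤ M * y ^ β := by
    intro y hy
    by_cases hya : y ∈ Ioi a
    · rw [hg, indicator_of_mem hya]; exact hM y hya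
    · rw [hg, indicator_of_notMem hya, abs_zero]; positivity
  have hkg : ∀ x, (fun y => k x y * g y) = (Ioi a).indicator fun y => k x y * f y := by
    intro x
    ext y
    by_cases hya : y ∈ Ioi a <;> simp [hg, hya, indicator]
  have hint : ∀ x, 0 < x → IntegrableOn (fun y => k x y * g y) (Ioi 0) := by
    intro x hx
    have := integrableOn_mul_of_le h0 h1 hβ0 hβ1 ha hx hf (hkc x hx) (hkC x hx)
    rw [hkg]
    exact ((integrable_indicator_iff measurableSet_Ioi).2 this).integrableOn
  have hscale : ∀ x, 0 < x → ∀ t, k x (x * t) * g (x * t) = x⁻¹ * (k 1 t * g (x * t)) := by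
    intro x hx t
    have := hk x hx 1 t
    rw [mul_one] at this
    rw [this, mul_assoc]
  have hint2 : ∀ x, 0 < x → IntegrableOn (fun t => k 1 t * g (x * t)) (Ioi 0) := by
    intro x hx
    have := (integrableOn_Ioi_comp_mul_left_iff (fun y => k x y * g y) 0 hx).2
      (by rw [mul_zero]; exact hint x hx)
    simp only [hscale x hx] at this
    have h2 := this.const_mul x
    simpa only [IntegrableOn, mul_inv_cancel_left₀ hx.ne'] using h2
  have heq : ∀ x, 0 < x → ∫ y in Ioi a, k x y * f y = ∫ t in Ioi 0, k 1 t * g (x * t) := by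
    intro x hx
    have := integral_comp_mul_left_Ioi (fun y => k x y * g y) 0 hx
    simp only [hscale x hx, mul_zero, smul_eq_mul] at this
    rw [integral_const_mul] at this
    rw [mul_left_cancel₀ (inv_ne_zero hx.ne') this, hkg,
      setIntegral_indicator measurableSet_Ioi,
      inter_eq_right.2 (Ioi_subset_Ioi ha)]
  rw [← integral_const_mul]
  have hmain : Tendsto (fun x => ∫ t in Ioi 0, x ^ (-β) * (k 1 t * g (x * t))) atTop
      (𝓝 (∫ t in Ioi 0, L * (k 1 t * t ^ β))) := by
    refine tendsto_integral_filter_of_dominated_convergence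
      (fun t => C * M * (kerAngle φ 1 t * t ^ β)) ?_ ?_
      ((integrableOn_kerAngle_mul_rpow h0 h1 hβ0 hβ1 one_pos).const_mul _) ?_
    · filter_upwards [eventually_gt_atTop 0] with x hx
      exact (hint2 x hx).1.const_mul _
    · filter_upwards [eventually_gt_atTop 0] with x hx
      filter_upwards [ae_restrict_mem measurableSet_Ioi] with t ht
      have ht0 : 0 < t := ht
      have hxb : 0 < x ^ β := by positivity
      have h2 := hgM (x * t) (by positivity)
      rw [Real.mul_rpow hx.le ht0.le] at h2
      rw [norm_mul, norm_mul, Real.norm_of_nonneg (by positivity), Real.norm_eq_abs,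
        Real.norm_eq_abs, Real.rpow_neg hx.le]
      have hk1 := hkC 1 one_pos t
      calc (x ^ β)⁻¹ * (|k 1 t| * |g (x * t)|)
          ≤ (x ^ β)⁻¹ * ((C * kerAngle φ 1 t) * (M * (x ^ β * t ^ β))) := by
            gcongr
            exact (abs_nonneg _).trans hk1
        _ = _ := by field_simp
    · filter_upwards [ae_restrict_mem measurableSet_Ioi] with t ht
      have ht0 : 0 < t := ht
      have hxt : Tendsto (fun x => x * t) atTop atTop := tendsto_id.atTop_mul_const ht0
      have := (hL.comp hxt).mul_const (k 1 t * t ^ β)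
      refine this.congr' ?_
      filter_upwards [eventually_gt_atTop 0, hxt.eventually_gt_atTop a] with x hx hxa
      have hgx : g (x * t) = f (x * t) := by
        rw [hg, indicator_of_mem (by exact hxa)]
      simp only [Function.comp_apply]
      rw [hgx, Real.mul_rpow hx.le ht0.le, Real.rpow_neg ht0.le]
      have : 0 < t ^ β := by positivity
      field_simp
  refine hmain.congr' ?_
  filter_upwards [eventually_gt_atTop 0] with x hx
  rw [heq x hx, integral_const_mul]

/-- Scaling identity for the power `y ^ β`. -/
lemma integral_kerAngle_mul_rpow (hx : 0 < x) :
    ∫ y in Ioi 0, kerAngle φ x y * y ^ β =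
      x ^ β * ∫ t in Ioi 0, kerAngle φ 1 t * t ^ β := by
  have h := integral_comp_mul_left_Ioi (fun y => kerAngle φ x y * y ^ β) 0 hx
  rw [mul_zero, smul_eq_mul] at h
  rw [← mul_left_cancel_iff_of_pos (inv_pos.2 hx), ← h, ← integral_const_mul,
    ← integral_const_mul]
  refine setIntegral_congr_fun measurableSet_Ioi fun t ht => ?_
  have := kerAngle_scale hx φ 1 t
  rw [mul_one] at this
  rw [this, Real.mul_rpow hx.le (le_of_lt ht)]
  ring

lemma integral_kerEuler_mul_rpow (h0 : 0 < φ) (h1 : φ < π) (hβ0 : 0 < β) (hβ1 : β < 1) :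
    ∫ t in Ioi 0, kerEuler φ 1 t * t ^ β = β * ∫ t in Ioi 0, kerAngle φ 1 t * t ^ β := by
  have h := hasDerivAt_integral_kerAngle h0 h1 hβ0 hβ1 le_rfl one_pos (rpowBounded_rpow hβ0)
  rw [div_one] at h
  have h2 := (Real.hasDerivAt_rpow_const (x := 1) (p := β) (Or.inl one_ne_zero)).mul_const
    (∫ t in Ioi 0, kerAngle φ 1 t * t ^ β)
  rw [Real.one_rpow, mul_one] at h2
  refine h.unique (h2.congr_of_eventuallyEq ?_)
  filter_upwards [lt_mem_nhds one_pos] with x hx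
  exact integral_kerAngle_mul_rpow hx

end

lemma growth_pos {α : ℝ} (hα : 1 < α) : 0 < (1 + α) / (2 * α) := by
  have : 0 < α := by linarith
  positivity

lemma growth_lt {α : ℝ} (hα : 1 < α) : (1 + α) / (2 * α) < 1 := by
  rw [div_lt_one (by linarith)]
  linarith

lemma integral_kerAngle_mul_tauF {α ξ : ℝ} (hα : 1 < α) (hξ : 1 ≤ ξ) :
    IntegrableOn (fun y => kerAngle (2 * π / (1 + α)) ξ y * tauF α y) (Ioi 1) ∧
    ∫ y in Ioi 1, kerAngle (2 * π / (1 + α)) ξ y * tauF α y = tauF α ξ + 2 := by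
  have hρ := rhoC_pos hα
  obtain ⟨hi, he⟩ := integral_kerAngle_mul_Sfun hα (le_mul_of_one_le_right hρ.le hξ)
  set φ := 2 * π / (1 + α)
  have hg : ∀ y, kerAngle φ (rhoC α * ξ) (rhoC α * y) * Sfun α (rhoC α * y) =
      (rhoC α)⁻¹ * (2 * (1 + α))⁻¹ * (kerAngle φ ξ y * tauF α y) := by
    intro y
    rw [kerAngle_scale hρ, tauF]
    have : 0 < 1 + α := by linarith
    field_simp
  have hi2 := (integrableOn_Ioi_comp_mul_left_iff
    (fun y => kerAngle φ (rhoC α * ξ) y * Sfun α y) 0 hρ).2 (by rwa [mul_zero])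
  have he2 := integral_comp_mul_left_Ioi
    (fun y => kerAngle φ (rhoC α * ξ) y * Sfun α y) 0 hρ
  simp only [hg] at hi2 he2
  have hα1 : 0 < 1 + α := by linarith
  have hi3 : IntegrableOn (fun y => kerAngle φ ξ y * tauF α y) (Ioi 0) := by
    have := hi2.const_mul (rhoC α * (2 * (1 + α)))
    refine this.congr (ae_of_all _ fun y => ?_)
    field_simp
  refine ⟨hi3.mono_set (Ioi_subset_Ioi zero_le_one), ?_⟩
  rw [integral_const_mul, mul_zero, he, smul_eq_mul,
    setIntegral_eq_of_subset_of_forall_sdiff_eq_zero (s := Ioi 1) measurableSet_Ioi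
      (Ioi_subset_Ioi zero_le_one)] at he2
  · rw [tauF]
    field_simp at he2
    linarith
  · rintro y ⟨-, hy⟩
    rw [mem_Ioi, not_lt] at hy
    rw [tauF_of_le_one hα hy, mul_zero]

lemma rpowBounded_tauF {α : ℝ} (hα : 1 < α) : RpowBounded 1 ((1 + α) / (2 * α)) (tauF α) := by
  obtain ⟨M, hM0, hM⟩ := exists_tauF_le hα
  refine ⟨?_, M, hM0.le, fun y hy => ?_⟩
  · have h := (integral_kerAngle_mul_tauF hα le_rfl).1.1
    have hk := continuous_kerAngle (angle_pos hα) (angle_lt hα) one_pos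
    have hp := kerAngle_pos (angle_pos hα) (angle_lt hα) one_pos
    have := (hk.inv₀ fun y => (hp y).ne').aestronglyMeasurable (μ := volume.restrict (Ioi 1))
    refine (this.mul h).congr (ae_of_all _ fun y => ?_)
    exact inv_mul_cancel_left₀ (hp y).ne' _
  · rw [abs_of_nonneg (tauF_nonneg hα y)]
    exact hM y (zero_lt_one.trans hy)

/-- The extension of `Dτ` to `(0, ∞)` given by the differentiated integral equation. -/
def eulerTau (α x : ℝ) : ℝ := ∫ y in Ioi 1, kerEuler (2 * π / (1 + α)) x y * tauF α y

lemma continuousAt_eulerTau {α x : ℝ} (hα : 1 < α) (hx : 0 < x) : ContinuousAt (eulerTau α) x :=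
  continuousAt_integral_kerEuler (angle_pos hα) (angle_lt hα) (growth_pos hα) (growth_lt hα)
    zero_le_one hx (rpowBounded_tauF hα)

lemma hasDerivAt_tauF_ext {α x : ℝ} (hα : 1 < α) (hx : 0 < x) :
    HasDerivAt (fun x => (∫ y in Ioi 1, kerAngle (2 * π / (1 + α)) x y * tauF α y) - 2)
      (eulerTau α x / x) x :=
  (hasDerivAt_integral_kerAngle (angle_pos hα) (angle_lt hα) (growth_pos hα) (growth_lt hα)
    zero_le_one hx (rpowBounded_tauF hα)).sub_const _

lemma tauF_eq_ext {α x : ℝ} (hα : 1 < α) (hx : 1 ≤ x) :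
    tauF α x = (∫ y in Ioi 1, kerAngle (2 * π / (1 + α)) x y * tauF α y) - 2 := by
  rw [(integral_kerAngle_mul_tauF hα hx).2, add_sub_cancel_right]

lemma hasDerivWithinAt_tauF {α x : ℝ} (hα : 1 < α) (hx : 1 ≤ x) :
    HasDerivWithinAt (tauF α) (eulerTau α x / x) (Ici 1) x :=
  (hasDerivAt_tauF_ext hα (by linarith)).hasDerivWithinAt.congr (fun _ hy => tauF_eq_ext hα hy)
    (tauF_eq_ext hα hx)

lemma hasDerivAt_tauF {α x : ℝ} (hα : 1 < α) (hx : 1 < x) :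
    HasDerivAt (tauF α) (eulerTau α x / x) x :=
  (hasDerivWithinAt_tauF hα hx.le).hasDerivAt (Ici_mem_nhds hx)

lemma Dtau_eq {α x : ℝ} (hα : 1 < α) (hx : 1 ≤ x) : Dtau α x = eulerTau α x := by
  have hx0 : x ≠ 0 := by linarith
  rw [Dtau, eulerDW, (hasDerivWithinAt_tauF hα hx).derivWithin (uniqueDiffOn_Ici 1 x hx),
    mul_div_cancel₀ _ hx0]

lemma continuousOn_tauF {α : ℝ} (hα : 1 < α) : ContinuousOn (tauF α) (Ici 1) :=
  fun _ hx => (hasDerivWithinAt_tauF hα hx).continuousWithinAt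

lemma continuousOn_eulerTau {α : ℝ} (hα : 1 < α) : ContinuousOn (eulerTau α) (Ici 1) :=
  fun _ hx => (continuousAt_eulerTau hα (zero_lt_one.trans_le hx)).continuousWithinAt

lemma rpowBounded_eulerTau {α : ℝ} (hα : 1 < α) :
    RpowBounded 1 ((1 + α) / (2 * α)) (eulerTau α) := by
  obtain ⟨M, hM0, hM⟩ := exists_tauF_le hα
  have h0 := angle_pos hα
  have h1 := angle_lt hα
  have hβ := growth_pos hα
  have hc := one_sub_abs_cos_pos h0 h1
  set φ := 2 * π / (1 + α) with hφ
  set D := (1 - |Real.cos φ|)⁻¹ with hD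
  have hD0 : 0 < D := inv_pos.2 hc
  refine ⟨((continuousOn_eulerTau hα).mono Ioi_subset_Ici_self).aestronglyMeasurable
    measurableSet_Ioi, D * (M + 2), by positivity, fun x hx => ?_⟩
  have hx0 : 0 < x := zero_lt_one.trans hx
  obtain ⟨hi, he⟩ := integral_kerAngle_mul_tauF hα (le_of_lt hx)
  have h2 : |eulerTau α x| ≤ ∫ y in Ioi 1, D * (kerAngle φ x y * tauF α y) := by
    rw [eulerTau, ← Real.norm_eq_abs]
    refine norm_integral_le_of_norm_le (hi.const_mul D) (ae_of_all _ fun y => ?_)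
    rw [norm_mul, Real.norm_of_nonneg (tauF_nonneg hα y), ← mul_assoc]
    exact mul_le_mul_of_nonneg_right (abs_kerEuler_le h0 h1 hx0 y) (tauF_nonneg hα y)
  rw [integral_const_mul, he] at h2
  refine h2.trans ?_
  have hone : 1 ≤ x ^ ((1 + α) / (2 * α)) := Real.one_le_rpow (le_of_lt hx) hβ.le
  rw [mul_assoc]
  refine mul_le_mul_of_nonneg_left ?_ hD0.le
  nlinarith [hM x hx0]

/-- The growth exponent makes the power `y ^ β` a fixed point of the full-line operator. -/
lemma integral_kerAngle_rpow_eq_one {α : ℝ} (hα : 1 < α) :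
    ∫ t in Ioi 0, kerAngle (2 * π / (1 + α)) 1 t * t ^ ((1 + α) / (2 * α)) = 1 := by
  have h0 := angle_pos hα
  have h1 := angle_lt hα
  have hβ := growth_pos hα
  have hA : 0 < Aconst α ^ ((1 + α) / (2 * α)) := Real.rpow_pos_of_pos (Aconst_pos hα) _
  have h := tendsto_integral_of_homogeneous (C := 1) h0 h1 hβ (growth_lt hα) zero_le_one
    (rpowBounded_tauF hα) (tendsto_tauF hα) (fun c hc => kerAngle_scale hc _)
    (fun x hx => continuous_kerAngle h0 h1 hx)
    (fun x hx y => by rw [one_mul, abs_of_pos (kerAngle_pos h0 h1 hx y)])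
  have h2 : Tendsto (fun x : ℝ => x ^ (-((1 + α) / (2 * α))) * tauF α x +
      x ^ (-((1 + α) / (2 * α))) * 2) atTop (𝓝 (Aconst α ^ ((1 + α) / (2 * α)))) := by
    simpa using (tendsto_tauF hα).add ((tendsto_rpow_neg_atTop hβ).mul_const 2)
  have h3 := tendsto_nhds_unique h (h2.congr' ?_)
  · exact mul_left_cancel₀ hA.ne' (h3.trans (mul_one _).symm)
  · filter_upwards [eventually_ge_atTop 1] with x hx
    rw [(integral_kerAngle_mul_tauF hα hx).2, mul_add]

lemma tendsto_eulerTau {α : ℝ} (hα : 1 < α) :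
    Tendsto (fun x => x ^ (-((1 + α) / (2 * α))) * eulerTau α x) atTop
      (𝓝 ((1 + α) / (2 * α) * Aconst α ^ ((1 + α) / (2 * α)))) := by
  have h0 := angle_pos hα
  have h1 := angle_lt hα
  have h := tendsto_integral_of_homogeneous h0 h1 (growth_pos hα) (growth_lt hα) zero_le_one
    (rpowBounded_tauF hα) (tendsto_tauF hα) (fun c hc => kerEuler_scale hc _)
    (fun x hx => continuous_kerEuler h0 h1 hx) (fun x hx => abs_kerEuler_le h0 h1 hx)
  rwa [integral_kerEuler_mul_rpow h0 h1 (growth_pos hα) (growth_lt hα),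
    integral_kerAngle_rpow_eq_one hα, mul_one,
    mul_comm (Aconst α ^ _)] at h

lemma tendsto_mul_kerAngle_mul_tauF {α x : ℝ} (hα : 1 < α) (hx : 0 < x) :
    Tendsto (fun y => y * kerAngle (2 * π / (1 + α)) x y * tauF α y) atTop (𝓝 0) := by
  obtain ⟨M, hM0, hM⟩ := exists_tauF_le hα
  have h0 := angle_pos hα
  have h1 := angle_lt hα
  have hc := one_sub_abs_cos_pos h0 h1
  have hβ : 0 < 1 - (1 + α) / (2 * α) := sub_pos.2 (growth_lt hα)
  set φ := 2 * π / (1 + α) with hφ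
  set D := (1 - |Real.cos φ|)⁻¹ with hD
  have hD0 : 0 < D := inv_pos.2 hc
  have hb := (tendsto_rpow_neg_atTop hβ).const_mul (D * x * M)
  rw [mul_zero] at hb
  refine squeeze_zero' ?_ ?_ hb
  · filter_upwards [eventually_gt_atTop 0] with y hy
    have := kerAngle_pos h0 h1 hx y
    have := tauF_nonneg hα y
    positivity
  · filter_upwards [eventually_gt_atTop 0] with y hy
    have hk : kerAngle φ x y ≤ D * (x / y ^ 2) := by
      refine (kerAngle_le h0 h1 hx y).trans ?_
      gcongr
      nlinarith [sq_nonneg x]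
    calc y * kerAngle φ x y * tauF α y
        ≤ y * (D * (x / y ^ 2)) * (M * y ^ ((1 + α) / (2 * α))) := by
          have := tauF_nonneg hα y
          gcongr
          exact hM y hy
      _ = D * x * M * y ^ (-(1 - (1 + α) / (2 * α))) := by
          rw [neg_sub, Real.rpow_sub_one hy.ne']
          field_simp

lemma integral_kerAngle_mul_eulerTau {α x : ℝ} (hα : 1 < α) (hx : 0 < x) :
    ∫ y in Ioi 1, kerAngle (2 * π / (1 + α)) x y * eulerTau α y = eulerTau α x := by
  have h0 := angle_pos hα
  have h1 := angle_lt hα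
  have hi := integrableOn_kerAngle_mul h0 h1 (growth_pos hα) (growth_lt hα) zero_le_one hx
    (rpowBounded_eulerTau hα)
  have hi2 := integrableOn_kerEuler_mul h0 h1 (growth_pos hα) (growth_lt hα) zero_le_one hx
    (rpowBounded_tauF hα)
  have h := integral_Ioi_of_hasDerivAt_of_tendsto (a := 1) (m := 0)
    (f := fun y => y * kerAngle (2 * π / (1 + α)) x y * tauF α y)
    (f' := fun y => kerAngle (2 * π / (1 + α)) x y * eulerTau α y -
      kerEuler (2 * π / (1 + α)) x y * tauF α y) ?_ ?_ (hi.sub hi2)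
    (tendsto_mul_kerAngle_mul_tauF hα hx)
  · rw [integral_sub hi hi2, tauF_of_le_one hα le_rfl, mul_zero, sub_zero] at h
    exact sub_eq_zero.1 h
  · refine ContinuousWithinAt.mul ?_ (continuousOn_tauF hα 1 self_mem_Ici)
    exact (continuous_id.mul (continuous_kerAngle h0 h1 hx)).continuousWithinAt
  · intro y hy
    have hy0 : y ≠ 0 := (zero_lt_one.trans hy).ne'
    refine ((hasDerivAt_mul_kerAngle h0 h1 hx y).mul (hasDerivAt_tauF hα hy)).congr_deriv ?_
    field_simp
    ring

lemma integral_sqrt_one_sub_sq_real : ∫ w : ℝ, √(1 - w ^ 2) = π / 2 := by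
  rw [← integral_sqrt_one_sub_sq, intervalIntegral.integral_of_le (by norm_num),
    ← setIntegral_univ]
  refine setIntegral_eq_of_subset_of_forall_sdiff_eq_zero MeasurableSet.univ (subset_univ _) ?_
  rintro w ⟨-, hw⟩
  refine Real.sqrt_eq_zero_of_nonpos ?_
  rw [mem_Ioc, not_and_or, not_lt, not_le] at hw
  rcases hw with hw | hw <;> nlinarith

lemma integral_sqrt_one_sub_mul_sq {c : ℝ} (hc : 0 < c) :
    ∫ v : ℝ, √(1 - c * v ^ 2) = π / (2 * √c) := by
  have h := Measure.integral_comp_mul_left (fun w => √(1 - w ^ 2)) (√c)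
  have hs : 0 < √c := Real.sqrt_pos.2 hc
  simp only [mul_pow, Real.sq_sqrt hc.le] at h
  rw [h, integral_sqrt_one_sub_sq_real, abs_of_pos (inv_pos.2 hs), smul_eq_mul]
  field_simp

lemma tendsto_exp_remainder (c : ℝ) :
    Tendsto (fun r => (Real.exp (c * r) - 1 - c * r - (c * r) ^ 2 / 2) / r ^ 2)
      (𝓝[>] 0) (𝓝 0) := by
  have hlim : Tendsto (fun r : ℝ => |c| ^ 3 * (2 / 9) * r) (𝓝[>] 0) (𝓝 0) := by
    have : Continuous fun r : ℝ => |c| ^ 3 * (2 / 9) * r := by fun_prop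
    simpa using (this.tendsto 0).mono_left nhdsWithin_le_nhds
  have hsmall : ∀ᶠ r : ℝ in 𝓝[>] 0, |c * r| ≤ 1 := by
    have : Continuous fun r : ℝ => |c * r| := by fun_prop
    have h0 := this.tendsto 0
    rw [mul_zero, abs_zero] at h0
    exact ((h0.mono_left nhdsWithin_le_nhds).eventually_lt_const one_pos).mono fun _ h => h.le
  refine squeeze_zero_norm' ?_ hlim
  filter_upwards [hsmall, self_mem_nhdsWithin] with r hr hr0
  have hr0 : 0 < r := hr0
  have h := Real.exp_bound hr (n := 3) (by norm_num)
  simp only [Finset.sum_range_succ, Finset.sum_range_zero, Nat.factorial] at h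
  norm_num at h
  rw [norm_div, Real.norm_eq_abs, Real.norm_of_nonneg (by positivity), div_le_iff₀ (by positivity),
    show Real.exp (c * r) - 1 - c * r - (c * r) ^ 2 / 2 =
      Real.exp (c * r) - (1 + c * r + (c * r) ^ 2 / 2) by ring]
  refine h.trans (le_of_eq ?_)
  rw [abs_of_pos hr0]
  ring

lemma tendsto_potExcess {α : ℝ} (hα : 1 < α) (v : ℝ) :
    Tendsto (fun r => potExcess α (r * v) / r ^ 2) (𝓝[>] 0) (𝓝 ((2 * α + 2) * v ^ 2)) := by
  have hα0 : α ≠ 0 := by linarith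
  have h := (((tendsto_exp_remainder (2 * α * v)).div_const α).add
    (tendsto_exp_remainder (-(2 * v)))).add_const ((2 * α + 2) * v ^ 2)
  rw [zero_div, zero_add, zero_add] at h
  refine h.congr' ?_
  filter_upwards [self_mem_nhdsWithin] with r hr0
  have hr0 : r ≠ 0 := (show (0 : ℝ) < r from hr0).ne'
  unfold potExcess
  rw [show 2 * α * v * r = 2 * α * (r * v) by ring, show -(2 * v) * r = -(2 * (r * v)) by ring]
  field_simp
  ring

/-- The rescaled action integral near the critical point. -/
def critInt (α r : ℝ) : ℝ := ∫ v, Real.exp (r * v) * √(1 - potExcess α (r * v) / r ^ 2)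

lemma tauF_eq_critInt {α r : ℝ} (hα : 1 < α) (hr : 0 < r) :
    tauF α (1 + α / (α + 1) * r ^ 2) = 2 * (1 + α) / π * r ^ 2 * critInt α r := by
  have hα0 : 0 < α := by linarith
  have hpi := pi_pos
  rw [tauF, Sfun_eq hα, critInt, ← integral_add_left_eq_self _ (logCrit α)]
  simp only [Vfun_exp_logCrit_add hα]
  have h := Measure.integral_comp_mul_left (fun s => √(Real.exp (2 * s) *
    ((α + 1) / α * (1 + α / (α + 1) * r ^ 2 - 1) - potExcess α s))) r
  rw [abs_of_pos (inv_pos.2 hr), smul_eq_mul] at h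
  have he : ∀ v, √(Real.exp (2 * (r * v)) *
      ((α + 1) / α * (1 + α / (α + 1) * r ^ 2 - 1) - potExcess α (r * v))) =
      r * (Real.exp (r * v) * √(1 - potExcess α (r * v) / r ^ 2)) := by
    intro v
    have : Real.exp (2 * (r * v)) *
        ((α + 1) / α * (1 + α / (α + 1) * r ^ 2 - 1) - potExcess α (r * v)) =
        (r * Real.exp (r * v)) ^ 2 * (1 - potExcess α (r * v) / r ^ 2) := by
      rw [mul_pow, ← Real.exp_nat_mul]
      push_cast
      field_simp
      ring
    rw [this, Real.sqrt_mul (by positivity), Real.sqrt_sq (by positivity), mul_assoc]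
  simp only [he] at h
  rw [integral_const_mul, eq_inv_mul_iff_mul_eq₀ hr.ne'] at h
  rw [← h]
  ring

lemma tendsto_critInt {α : ℝ} (hα : 1 < α) :
    Tendsto (critInt α) (𝓝[>] 0) (𝓝 (π / (2 * √(2 * α + 2)))) := by
  rw [← integral_sqrt_one_sub_mul_sq (by linarith)]
  unfold critInt
  refine tendsto_integral_filter_of_dominated_convergence
    ((Icc (-1) 1).indicator fun _ => Real.exp 1) ?_ ?_ ?_ (ae_of_all _ fun v => ?_)
  · filter_upwards with r
    refine Continuous.aestronglyMeasurable ?_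
    unfold potExcess
    fun_prop
  · filter_upwards [Ioo_mem_nhdsGT (zero_lt_one' ℝ)] with r hr
    refine ae_of_all _ fun v => ?_
    rw [Real.norm_of_nonneg (by positivity)]
    have hp := two_mul_sq_le_potExcess hα (r * v)
    have hr2 : 0 < r ^ 2 := pow_pos hr.1 2
    by_cases hv : v ∈ Icc (-1) 1
    · rw [indicator_of_mem hv, ← mul_one (Real.exp 1)]
      have h1 : 0 ≤ potExcess α (r * v) / r ^ 2 :=
        div_nonneg (le_trans (by positivity) hp) hr2.le
      refine mul_le_mul (Real.exp_le_exp.2 ?_) (Real.sqrt_le_one.2 (by linarith))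
        (Real.sqrt_nonneg _) (Real.exp_pos _).le
      nlinarith [hv.2, hr.1, hr.2]
    · rw [indicator_of_notMem hv]
      have hv2 : 1 ≤ v ^ 2 := by
        rw [mem_Icc, ← abs_le, not_le] at hv
        rw [← sq_abs]
        nlinarith
      have h1 : 1 ≤ potExcess α (r * v) / r ^ 2 := by
        rw [le_div_iff₀ hr2]
        nlinarith
      rw [Real.sqrt_eq_zero_of_nonpos (by linarith), mul_zero]
  · exact (integrable_indicator_iff measurableSet_Icc).2 (integrableOn_const (by simp))
  · have h1 : Tendsto (fun r => Real.exp (r * v)) (𝓝[>] 0) (𝓝 1) := by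
      have : Continuous fun r => Real.exp (r * v) := by fun_prop
      simpa using (this.tendsto 0).mono_left nhdsWithin_le_nhds
    have := h1.mul ((tendsto_potExcess hα v).const_sub 1).sqrt
    rwa [one_mul] at this

lemma eulerTau_one {α : ℝ} (hα : 1 < α) :
    eulerTau α 1 = (1 + α) / (2 * α) * √(2 * (1 + α)) := by
  have hα0 : 0 < α := by linarith
  have hpi := pi_pos
  have h := hasDerivWithinAt_tauF hα le_rfl
  rw [div_one, hasDerivWithinAt_iff_tendsto_slope] at h
  have hu : Tendsto (fun r => 1 + α / (α + 1) * r ^ 2) (𝓝[>] 0) (𝓝[Ici 1 \ {1}] 1) := by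
    refine tendsto_nhdsWithin_iff.2 ⟨?_, ?_⟩
    · have : Continuous fun r : ℝ => 1 + α / (α + 1) * r ^ 2 := by fun_prop
      simpa using (this.tendsto 0).mono_left nhdsWithin_le_nhds
    · filter_upwards [self_mem_nhdsWithin] with r hr
      have hr : (0 : ℝ) < r := hr
      have : 0 < α / (α + 1) * r ^ 2 := by positivity
      exact ⟨by simp [this.le], by simp [this.ne']⟩
  have h1 := h.comp hu
  have h2 := (tendsto_critInt hα).const_mul (2 * (1 + α) / π * ((α + 1) / α))
  have h3 := tendsto_nhds_unique h1 (h2.congr' ?_)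
  · rw [h3, show 2 * α + 2 = 2 * (1 + α) by ring]
    have hs : √(2 * (1 + α)) ^ 2 = 2 * (1 + α) := Real.sq_sqrt (by linarith)
    have hs0 : 0 < √(2 * (1 + α)) := by positivity
    field_simp
    rw [hs]
    ring
  · filter_upwards [self_mem_nhdsWithin] with r hr
    have hr : (0 : ℝ) < r := hr
    simp only [Function.comp_apply, slope_def_field]
    rw [tauF_eq_critInt hα hr, tauF_of_le_one hα le_rfl]
    field_simp
    ring

lemma Kconv_Ici {α ω : ℝ} (hω : 0 < ω) (l : ℝ → ℝ) (x : ℝ) :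
    Kconv α (Ici ω) l x = ∫ y in Ioi ω, kerAngle (2 * π / (1 + α)) x y * l y := by
  rw [Kconv, integral_Ici_eq_integral_Ioi]
  exact setIntegral_congr_fun measurableSet_Ioi fun y hy => Ka_div_eq (hω.trans hy) _

lemma integral_kerAngle_comp_div {φ ω : ℝ} (hω : 0 < ω) (g : ℝ → ℝ) (x : ℝ) :
    ∫ y in Ioi ω, kerAngle φ x y * g (y / ω) =
      ∫ y in Ioi 1, kerAngle φ (x / ω) y * g y := by
  have h := integral_comp_mul_left_Ioi (fun y => kerAngle φ x y * g (y / ω)) 1 hω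
  rw [mul_one, smul_eq_mul] at h
  rw [← mul_left_cancel_iff_of_pos (inv_pos.2 hω), ← h, ← integral_const_mul]
  refine setIntegral_congr_fun measurableSet_Ioi fun y _ => ?_
  have := kerAngle_scale hω φ (x / ω) y
  rw [mul_div_cancel₀ _ hω.ne'] at this
  rw [this, mul_div_cancel_left₀ _ hω.ne', mul_assoc]

/-- `l̄(·; ω, p)` with `Dτ` replaced by its extension `eulerTau`. -/
def lbarExt (α ω p ξ : ℝ) : ℝ :=
  p * tauF α ξ - (2 * α / (1 + α)) * (p - (ω / Aconst α) ^ ((1 + α) / (2 * α))) * eulerTau α ξ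

lemma lbar_eq_ext {α ω p ξ : ℝ} (hα : 1 < α) (hξ : 1 ≤ ξ) :
    lbar α ω p ξ = lbarExt α ω p ξ := by
  rw [lbar, lbarExt, Dtau_eq hα hξ]

lemma lbar_one {α ω p : ℝ} (hα : 1 < α) :
    lbar α ω p 1 = √(2 * (1 + α)) * ((ω / Aconst α) ^ ((1 + α) / (2 * α)) - p) := by
  have hα0 : 0 < α := by linarith
  rw [lbar_eq_ext hα le_rfl, lbarExt, eulerTau_one hα, tauF_of_le_one hα le_rfl]
  field_simp
  ring

lemma continuousOn_lbarExt {α ω p : ℝ} (hα : 1 < α) : ContinuousOn (lbarExt α ω p) (Ici 1) :=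
  (continuousOn_const.mul (continuousOn_tauF hα)).sub
    (continuousOn_const.mul (continuousOn_eulerTau hα))

lemma tendsto_lbarExt {α ω p : ℝ} (hα : 1 < α) (hω : 0 < ω) :
    Tendsto (fun ξ => ξ ^ (-((1 + α) / (2 * α))) * lbarExt α ω p ξ) atTop
      (𝓝 (ω ^ ((1 + α) / (2 * α)))) := by
  have hα0 : 0 < α := by linarith
  have hA := Aconst_pos hα
  have h := ((tendsto_tauF hα).const_mul p).sub ((tendsto_eulerTau hα).const_mul
    ((2 * α / (1 + α)) * (p - (ω / Aconst α) ^ ((1 + α) / (2 * α)))))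
  have he : p * Aconst α ^ ((1 + α) / (2 * α)) -
      2 * α / (1 + α) * (p - (ω / Aconst α) ^ ((1 + α) / (2 * α))) *
        ((1 + α) / (2 * α) * Aconst α ^ ((1 + α) / (2 * α))) = ω ^ ((1 + α) / (2 * α)) := by
    rw [Real.div_rpow hω.le hA.le]
    have : 0 < Aconst α ^ ((1 + α) / (2 * α)) := Real.rpow_pos_of_pos hA _
    have hα1 : 0 < 1 + α := by linarith
    generalize Aconst α ^ ((1 + α) / (2 * α)) = B at *
    generalize ω ^ ((1 + α) / (2 * α)) = W
    field_simp
    ring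
  rw [he] at h
  refine h.congr fun ξ => ?_
  unfold lbarExt
  ring

lemma lbarExt_eq {α ω p ξ : ℝ} (hα : 1 < α) (hξ : 1 ≤ ξ) :
    lbarExt α ω p ξ = -2 * p +
      ∫ y in Ioi 1, kerAngle (2 * π / (1 + α)) ξ y * lbarExt α ω p y := by
  obtain ⟨hi, he⟩ := integral_kerAngle_mul_tauF hα hξ
  have hξ0 : 0 < ξ := by linarith
  have hi2 := integrableOn_kerAngle_mul (angle_pos hα) (angle_lt hα) (growth_pos hα)
    (growth_lt hα) zero_le_one hξ0 (rpowBounded_eulerTau hα)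
  have he2 := integral_kerAngle_mul_eulerTau hα hξ0
  unfold lbarExt
  simp only [mul_sub (kerAngle _ _ _), mul_left_comm (kerAngle _ _ _)]
  rw [integral_sub (hi.const_mul _) (hi2.const_mul _), integral_const_mul, integral_const_mul,
    he, he2]
  ring

lemma rpow_neg_bounded_of_tendsto {β ω L : ℝ} (hω : 0 < ω) {l : ℝ → ℝ}
    (hc : ContinuousOn l (Ici ω)) (hL : Tendsto (fun x => x ^ (-β) * l x) atTop (𝓝 L)) :
    ∃ M, ∀ x, ω ≤ x → |x ^ (-β) * l x| ≤ M := by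
  have hg : ContinuousOn (fun x => |x ^ (-β) * l x|) (Ici ω) := by
    refine (ContinuousOn.mul (fun x hx => ?_) hc).abs
    exact (Real.continuousAt_rpow_const _ _
      (Or.inl (hω.trans_le hx).ne')).continuousWithinAt
  obtain ⟨R, hR⟩ := ((hL.abs.eventually_lt_const (lt_add_one |L|))).exists_forall_of_atTop
  obtain ⟨B, hB⟩ := (isCompact_Icc (a := ω) (b := R)).bddAbove_image
    (hg.mono Icc_subset_Ici_self)
  refine ⟨max B (|L| + 1), fun x hx => ?_⟩
  rcases le_total x R with h | h
  · exact le_max_of_le_left (hB (mem_image_of_mem _ ⟨hx, h⟩))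
  · exact le_max_of_le_right (hR x h).le

lemma rpowBounded_of_continuousOn {β ω M : ℝ} (hω : 0 < ω) {l : ℝ → ℝ}
    (hc : ContinuousOn l (Ici ω)) (hM : ∀ x, ω ≤ x → |x ^ (-β) * l x| ≤ M) :
    RpowBounded ω β l := by
  refine ⟨(hc.mono Ioi_subset_Ici_self).aestronglyMeasurable measurableSet_Ioi, M,
    (abs_nonneg _).trans (hM ω le_rfl), fun y hy => ?_⟩
  have hy0 : 0 < y := hω.trans hy
  have h := hM y (le_of_lt hy)
  rw [abs_mul, abs_of_pos (Real.rpow_pos_of_pos hy0 _), Real.rpow_neg hy0.le,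
    inv_mul_le_iff₀ (Real.rpow_pos_of_pos hy0 _)] at h
  linarith

lemma exists_abs_max {ω : ℝ} {g : ℝ → ℝ} (hg : ContinuousOn g (Ici ω))
    (h0 : Tendsto g atTop (𝓝 0)) {x₁ : ℝ} (hx₁ : ω ≤ x₁) (h1 : g x₁ ≠ 0) :
    ∃ x₀, ω ≤ x₀ ∧ 0 < |g x₀| ∧ ∀ y, ω ≤ y → |g y| ≤ |g x₀| := by
  have h0' := h0.abs
  rw [abs_zero] at h0'
  obtain ⟨R, hR⟩ := (h0'.eventually_lt_const (abs_pos.2 h1)).exists_forall_of_atTop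
  have hmem : x₁ ∈ Icc ω (max R x₁) := ⟨hx₁, le_max_right _ _⟩
  obtain ⟨x₀, hx₀, hmax⟩ := isCompact_Icc.exists_isMaxOn ⟨x₁, hmem⟩
    (hg.mono Icc_subset_Ici_self).abs
  have h10 : |g x₁| ≤ |g x₀| := hmax hmem
  refine ⟨x₀, hx₀.1, (abs_pos.2 h1).trans_le h10, fun y hy => ?_⟩
  rcases le_total y (max R x₁) with h | h
  · exact hmax ⟨hy, h⟩
  · exact (hR y ((le_max_left _ _).trans h)).le.trans h10

lemma integral_Ioi_kerAngle_rpow_lt {α ω x : ℝ} (hα : 1 < α) (hω : 0 < ω) (hx : 0 < x) :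
    ∫ y in Ioi ω, kerAngle (2 * π / (1 + α)) x y * y ^ ((1 + α) / (2 * α)) <
      x ^ ((1 + α) / (2 * α)) := by
  have hi := integrableOn_kerAngle_mul_rpow (angle_pos hα) (angle_lt hα) (growth_pos hα)
    (growth_lt hα) hx
  have hw : IntervalIntegrable
      (fun y => kerAngle (2 * π / (1 + α)) x y * y ^ ((1 + α) / (2 * α))) volume 0 ω :=
    (intervalIntegrable_iff_integrableOn_Ioc_of_le hω.le).2 (hi.mono_set Ioc_subset_Ioi_self)
  have hpos := intervalIntegral.intervalIntegral_pos_of_pos_on hw (fun y hy =>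
    mul_pos (kerAngle_pos (angle_pos hα) (angle_lt hα) hx y) (Real.rpow_pos_of_pos hy.1 _)) hω
  have hadd := intervalIntegral.integral_interval_add_Ioi' hw
    (hi.mono_set (Ioi_subset_Ioi hω.le))
  rw [integral_kerAngle_mul_rpow hx, integral_kerAngle_rpow_eq_one hα, mul_one] at hadd
  linarith

lemma homogeneous_unique {α ω : ℝ} (hα : 1 < α) (hω : 0 < ω) {d : ℝ → ℝ}
    (hc : ContinuousOn d (Ici ω))
    (h0 : Tendsto (fun x => x ^ (-((1 + α) / (2 * α))) * d x) atTop (𝓝 0))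
    (heq : ∀ x, ω ≤ x → d x = ∫ y in Ioi ω, kerAngle (2 * π / (1 + α)) x y * d y) {x : ℝ}
    (hx : ω ≤ x) : d x = 0 := by
  by_contra hne
  set β := (1 + α) / (2 * α) with hβ
  have hg : ContinuousOn (fun x => x ^ (-β) * d x) (Ici ω) := by
    refine ContinuousOn.mul (fun x hx => ?_) hc
    exact (Real.continuousAt_rpow_const _ _ (Or.inl (hω.trans_le hx).ne')).continuousWithinAt
  obtain ⟨x₀, hx₀, hm, hmax⟩ := exists_abs_max hg h0 hx
    (mul_ne_zero (Real.rpow_pos_of_pos (hω.trans_le hx) _).ne' hne)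
  have hx₀0 : 0 < x₀ := hω.trans_le hx₀
  set m := |x₀ ^ (-β) * d x₀| with hmdef
  have hd : ∀ y, ω ≤ y → |d y| ≤ m * y ^ β := by
    intro y hy
    have hy0 : 0 < y := hω.trans_le hy
    have h := hmax y hy
    rw [abs_mul, abs_of_pos (Real.rpow_pos_of_pos hy0 _), Real.rpow_neg hy0.le,
      inv_mul_le_iff₀ (Real.rpow_pos_of_pos hy0 _)] at h
    linarith
  have hi := ((integrableOn_kerAngle_mul_rpow (angle_pos hα) (angle_lt hα) (growth_pos hα)
    (growth_lt hα) hx₀0).mono_set (Ioi_subset_Ioi hω.le)).const_mul m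
  have hle : |d x₀| ≤ ∫ y in Ioi ω, m * (kerAngle (2 * π / (1 + α)) x₀ y * y ^ β) := by
    rw [heq x₀ hx₀, ← Real.norm_eq_abs]
    refine norm_integral_le_of_norm_le hi ?_
    filter_upwards [ae_restrict_mem measurableSet_Ioi] with y hy
    have hk := (kerAngle_pos (angle_pos hα) (angle_lt hα) hx₀0 y).le
    rw [norm_mul, Real.norm_of_nonneg hk, Real.norm_eq_abs, mul_left_comm]
    exact mul_le_mul_of_nonneg_left (hd y (le_of_lt hy)) hk
  rw [integral_const_mul] at hle
  have hlt := mul_lt_mul_of_pos_left (integral_Ioi_kerAngle_rpow_lt hα hω hx₀0) hm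
  have hval : m * x₀ ^ β = |d x₀| := by
    rw [hmdef, abs_mul, abs_of_pos (Real.rpow_pos_of_pos hx₀0 _), Real.rpow_neg hx₀0.le]
    have := Real.rpow_pos_of_pos hx₀0 β
    field_simp
  linarith

theorem statement9 (α p ω : ℝ) (hα : 1 < α) (hp : 0 ≤ p) (hω : 0 < ω) :
    -- the linearised IBA equation has a unique continuous normalised solution,
    -- given explicitly by l(x) = l̄(x/ω; ω, p)
    (∀ l : ℝ → ℝ,
      (ContinuousOn l (Set.Ici ω) ∧
        (∃ M : ℝ, ∀ x : ℝ, ω ≤ x → |x ^ (-((1 + α) / (2 * α))) * l x| ≤ M) ∧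
        Tendsto (fun x : ℝ => x ^ (-((1 + α) / (2 * α))) * l x) atTop (𝓝 1) ∧
        (∀ x : ℝ, ω ≤ x → l x = -2 * p + Kconv α (Set.Ici ω) l x)) ↔
      (∀ x : ℝ, ω ≤ x → l x = lbar α ω p (x / ω))) ∧
    -- l̄(1; ω, p) = √(2(1+α))·[(ω/A)^{(1+α)/(2α)} − p]
    lbar α ω p 1 = Real.sqrt (2 * (1 + α)) * ((ω / Aconst α) ^ ((1 + α) / (2 * α)) - p) := by
  refine ⟨fun l => ?_, lbar_one hα⟩
  have hdiv : ∀ x, ω ≤ x → 1 ≤ x / ω := fun x hx => (one_le_div hω).2 hx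
  have hext : ∀ x, ω ≤ x → lbar α ω p (x / ω) = lbarExt α ω p (x / ω) :=
    fun x hx => lbar_eq_ext hα (hdiv x hx)
  have hLc : ContinuousOn (fun x => lbarExt α ω p (x / ω)) (Ici ω) :=
    (continuousOn_lbarExt hα).comp (continuous_id.div_const ω).continuousOn hdiv
  have hLt : Tendsto (fun x : ℝ => x ^ (-((1 + α) / (2 * α))) * lbarExt α ω p (x / ω))
      atTop (𝓝 1) := by
    have hωβ : 0 < ω ^ ((1 + α) / (2 * α)) := Real.rpow_pos_of_pos hω _
    have h := ((tendsto_lbarExt (p := p) hα hω).comp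
      (tendsto_id.atTop_div_const hω)).const_mul (ω ^ ((1 + α) / (2 * α)))⁻¹
    rw [inv_mul_cancel₀ hωβ.ne'] at h
    refine h.congr' ?_
    filter_upwards [eventually_gt_atTop 0] with x hx
    simp only [Function.comp_apply, id]
    rw [Real.div_rpow hx.le hω.le, Real.rpow_neg hω.le]
    field_simp
  have hLe : ∀ x, ω ≤ x → lbarExt α ω p (x / ω) = -2 * p +
      ∫ y in Ioi ω, kerAngle (2 * π / (1 + α)) x y * lbarExt α ω p (y / ω) := fun x hx => by
    rw [integral_kerAngle_comp_div hω, ← lbarExt_eq hα (hdiv x hx)]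
  obtain ⟨M₀, hM₀⟩ := rpow_neg_bounded_of_tendsto hω hLc hLt
  constructor
  · rintro ⟨hc, ⟨M, hM⟩, ht, he⟩ x hx
    rw [hext x hx, ← sub_eq_zero]
    refine homogeneous_unique hα hω (hc.sub hLc) ?_ (fun z hz => ?_) hx
    · have := ht.sub hLt
      rw [sub_self] at this
      exact this.congr fun z => by simp only [Pi.sub_apply]; ring
    · have hz0 : 0 < z := hω.trans_le hz
      have hi1 := integrableOn_kerAngle_mul (angle_pos hα) (angle_lt hα) (growth_pos hα)
        (growth_lt hα) hω.le hz0 (rpowBounded_of_continuousOn hω hc hM)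
      have hi2 := integrableOn_kerAngle_mul (angle_pos hα) (angle_lt hα) (growth_pos hα)
        (growth_lt hα) hω.le hz0 (rpowBounded_of_continuousOn hω hLc hM₀)
      simp only [Pi.sub_apply, mul_sub]
      rw [integral_sub hi1 hi2, he z hz, Kconv_Ici hω, hLe z hz]
      ring
  · intro h
    have hl : ∀ x, ω ≤ x → l x = lbarExt α ω p (x / ω) := fun x hx => (h x hx).trans (hext x hx)
    refine ⟨hLc.congr hl, ⟨M₀, fun x hx => ?_⟩, ?_, fun x hx => ?_⟩
    · rw [hl x hx]; exact hM₀ x hx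
    · refine hLt.congr' ?_
      filter_upwards [eventually_ge_atTop ω] with x hx
      rw [hl x hx]
    · rw [Kconv_Ici hω, hl x hx, hLe x hx]
      congr 1
      refine setIntegral_congr_fun measurableSet_Ioi fun y hy => ?_
      rw [hl y (le_of_lt hy)]
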